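/- arXiv:2404.06445 — 3 statements merged into one kernel-verified Lean document; each statement's English description precedes it below -/
import Mathlib

section
/- Let G be a minimal bipartite matching covered graph that is not isomorphic to the cycle graph on 4 vertices. Then G has at most (3n − 6)/2 edges, i.e. 2m + 6 ≤ 3n, where n is the number of vertices and m the number of edges of G. -/
open SimpleGraph

/-- The degree of a vertex `v` in a graph `G`: the number of neighbours of `v`. -/
noncomputable def degN {V : Type*} (G : SimpleGraph V) (v : V) : ℕ :=
  (G.neighborSet v).ncard

/-- A finite simple graph is matching covered if it is connected, has at least 4 vertices,
and every edge lies in some perfect matching. -/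
def MatchingCovered {V : Type*} [Fintype V] (G : SimpleGraph V) : Prop :=
  G.Connected ∧ 4 ≤ Fintype.card V ∧
    ∀ e ∈ G.edgeSet, ∃ M : G.Subgraph, M.IsPerfectMatching ∧ e ∈ M.edgeSet

/-- A matching covered graph is minimal if deleting any edge destroys the property. -/
def MinimalMatchingCovered {V : Type*} [Fintype V] (G : SimpleGraph V) : Prop :=
  MatchingCovered G ∧ ∀ e ∈ G.edgeSet, ¬ MatchingCovered (G.deleteEdges {e})

namespace BipartiteCover

variable {ι : Type*}

/-- Every nonempty proper subset is left by some related pair. -/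
def CutStrong (R : ι → ι → Prop) : Prop :=
  ∀ X : Set ι, X.Nonempty → X ≠ Set.univ → ∃ i ∈ X, ∃ j ∉ X, R i j

lemma CutStrong.flip {R : ι → ι → Prop} (h : CutStrong R) : CutStrong fun i j => R j i := by
  intro X hX hX'
  obtain ⟨i, hi, j, hj, hij⟩ := h Xᶜ (Set.nonempty_compl.2 hX')
    (by simpa [Set.compl_univ_iff] using hX.ne_empty)
  exact ⟨j, not_not.1 hj, i, hi, hij⟩

/-- A ranking by distance to a nonempty set, every other element having a successor of
smaller rank. -/
lemma CutStrong.exists_rank {R : ι → ι → Prop} (h : CutStrong R) {S : Set ι} (hS : S.Nonempty) :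
    ∃ (d : ι → ℕ) (f : ι → ι), ∀ x ∉ S, R x (f x) ∧ d (f x) < d x := by
  classical
  let L : ℕ → Set ι := fun n =>
    Nat.rec (motive := fun _ => Set ι) S (fun _ T => T ∪ {x | ∃ y ∈ T, R x y}) n
  have hL : ∀ x, ∃ n, x ∈ L n := by
    by_contra! hcon
    obtain ⟨x, hx⟩ := hcon
    obtain ⟨s, hs⟩ := hS
    obtain ⟨i, hi, j, hj, hij⟩ := h {x | ∀ n, x ∉ L n} ⟨x, hx⟩
      (fun he => (he ▸ Set.mem_univ s : s ∈ {x | ∀ n, x ∉ L n}) 0 hs)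
    simp only [Set.mem_ofPred_eq, not_forall, not_not] at hj
    obtain ⟨n, hn⟩ := hj
    exact hi (n + 1) (Or.inr ⟨j, hn, hij⟩)
  let d : ι → ℕ := fun x => Nat.find (p := fun n => x ∈ L n) (hL x)
  have key : ∀ x, ∃ y, x ∉ S → R x y ∧ d y < d x := by
    intro x
    by_cases hx : x ∈ S
    · exact ⟨x, fun h => absurd hx h⟩
    have hspec := Nat.find_spec (hL x)
    obtain ⟨n, hn⟩ : ∃ n, d x = n + 1 := by
      refine Nat.exists_eq_succ_of_ne_zero fun h0 => hx ?_
      change x ∈ L (d x) at hspec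
      rw [h0] at hspec
      exact hspec
    change x ∈ L (d x) at hspec
    rw [hn] at hspec
    rcases hspec with hx' | ⟨y, hy, hxy⟩
    · exact absurd hx' (Nat.find_min (hL x) (show n < d x by omega))
    · refine ⟨y, fun _ => ⟨hxy, ?_⟩⟩
      have : d y ≤ n := Nat.find_min' (hL y) hy
      omega
  choose f hf using key
  exact ⟨d, f, hf⟩

variable {V : Type*} {G : SimpleGraph V}

/-- The pairs `(i, j)` for which the `i`-th vertex of the first class is adjacent to the `j`-th
vertex of the second class. -/
def crossRel (G : SimpleGraph V) (f : ι ⊕ ι ≃ V) (i j : ι) : Prop :=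
  G.Adj (f (.inl i)) (f (.inr j))

/-- The map `f` enumerates the two colour classes of a bipartition of `G`. -/
def IsBipartitionBy (G : SimpleGraph V) (f : ι ⊕ ι ≃ V) : Prop :=
  ∀ i j, ¬ G.Adj (f (.inl i)) (f (.inl j)) ∧ ¬ G.Adj (f (.inr i)) (f (.inr j))

lemma exists_adj_boundary (hG : G.Connected) {C : Set V} {u v : V} (hu : u ∈ C) (hv : v ∉ C) :
    ∃ x ∈ C, ∃ y ∉ C, G.Adj x y := by
  obtain ⟨p⟩ := hG.preconnected u v
  obtain ⟨e, -, h1, h2⟩ := p.exists_boundary_dart C hu hv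
  exact ⟨_, h1, _, h2, e.adj⟩

/-- A perfect matching of a bipartite graph, viewed as a self-map of the index type. -/
lemma IsBipartitionBy.exists_injective {f : ι ⊕ ι ≃ V} (hf : IsBipartitionBy G f)
    {M : G.Subgraph} (hM : M.IsPerfectMatching) :
    ∃ σ : ι → ι, σ.Injective ∧ ∀ i j, M.Adj (f (.inl i)) (f (.inr j)) ↔ σ i = j := by
  rw [Subgraph.isPerfectMatching_iff] at hM
  have h : ∀ i, ∃ j, M.Adj (f (.inl i)) (f (.inr j)) := by
    intro i
    obtain ⟨w, hw, -⟩ := hM (f (.inl i))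
    obtain ⟨k | k, rfl⟩ := f.surjective w
    · exact absurd (M.adj_sub hw) (hf i k).1
    · exact ⟨k, hw⟩
  choose σ hσ using h
  refine ⟨σ, fun i k hik => ?_, fun i j => ⟨fun hij => ?_, fun h => h ▸ hσ i⟩⟩
  · have := (hM (f (.inr (σ i)))).unique (hσ i).symm (hik ▸ (hσ k).symm)
    simpa using this
  · have := (hM (f (.inl i))).unique (hσ i) hij
    simpa using this

/-- The perfect matching of `G` given by a permutation of the index type. -/
lemma exists_perfectMatching_of_perm (f : ι ⊕ ι ≃ V) (σ : ι ≃ ι)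
    (hσ : ∀ i, crossRel G f i (σ i)) :
    ∃ M : G.Subgraph, M.IsPerfectMatching ∧ ∀ i, M.Adj (f (.inl i)) (f (.inr (σ i))) := by
  let P : V → V → Prop := fun u v => ∃ i, u = f (.inl i) ∧ v = f (.inr (σ i))
  let M : G.Subgraph :=
    { verts := Set.univ
      Adj := fun u v => P u v ∨ P v u
      adj_sub := by
        rintro u v (⟨i, rfl, rfl⟩ | ⟨i, rfl, rfl⟩)
        · exact hσ i
        · exact (hσ i).symm
      edge_vert := fun _ => Set.mem_univ _
      symm := ⟨fun u v h => h.symm⟩ }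
  refine ⟨M, Subgraph.isPerfectMatching_iff.2 fun v => ?_, fun i => Or.inl ⟨i, rfl, rfl⟩⟩
  obtain ⟨i | j, rfl⟩ := f.surjective v
  · refine ⟨f (.inr (σ i)), Or.inl ⟨i, rfl, rfl⟩, ?_⟩
    rintro w (⟨k, hk, rfl⟩ | ⟨k, -, hk⟩)
    · simp_all
    · simp at hk
  · refine ⟨f (.inl (σ.symm j)), Or.inr ⟨σ.symm j, rfl, by simp⟩, ?_⟩
    rintro w (⟨k, hk, -⟩ | ⟨k, rfl, hk⟩)
    · simp at hk
    · simp_all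

/-- A bipartite graph with a perfect matching has an enumeration of its colour classes
in which equally indexed vertices are matched. -/
lemma exists_isBipartitionBy (hbip : G.Colorable 2) {M : G.Subgraph} (hM : M.IsPerfectMatching) :
    ∃ (A : Set V) (f : A ⊕ A ≃ V), IsBipartitionBy G f ∧ ∀ i, crossRel G f i i := by
  classical
  obtain ⟨c⟩ := hbip
  rw [Subgraph.isPerfectMatching_iff] at hM
  choose m hm hm' using hM
  have hmm : ∀ v, m (m v) = v := fun v => (hm' _ _ (hm v).symm).symm
  have hcm : ∀ v, c (m v) ≠ c v := fun v => (c.valid (M.adj_sub (hm v))).symm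
  have h2 : ∀ x y : Fin 2, x ≠ y → (x = 0 ↔ ¬ y = 0) := by decide
  have h2' : ∀ x y : Fin 2, ¬ x = 0 → ¬ y = 0 → x = y := by decide
  have hc0 : ∀ v, c (m v) = 0 ↔ ¬ c v = 0 := fun v => h2 _ _ (hcm v)
  let A : Set V := {v | c v = 0}
  let g : A ⊕ A → V := Sum.elim (fun a => a) (fun a => m a)
  have hg : g.Bijective := by
    constructor
    · rintro (⟨a, ha⟩ | ⟨a, ha⟩) (⟨b, hb⟩ | ⟨b, hb⟩) hab
      · simpa [g] using hab
      · have : a = m b := hab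
        subst this
        exact absurd hb ((hc0 b).1 ha)
      · have : m a = b := hab
        subst this
        exact absurd ha ((hc0 a).1 hb)
      · have : m a = m b := hab
        have : a = b := by rw [← hmm a, this, hmm]
        subst this; rfl
    · intro v
      by_cases hv : c v = 0
      · exact ⟨.inl ⟨v, hv⟩, rfl⟩
      · exact ⟨.inr ⟨m v, (hc0 v).2 hv⟩, hmm v⟩
  refine ⟨A, Equiv.ofBijective g hg, fun i j => ⟨fun h => ?_, fun h => ?_⟩, fun i => ?_⟩
  · exact c.valid h (i.2.trans j.2.symm)
  · refine c.valid h (h2' _ _ (fun h0 => ?_) fun h0 => ?_)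
    · exact (hc0 i).1 h0 i.2
    · exact (hc0 j).1 h0 j.2
  · exact M.adj_sub (hm i)

variable [Fintype ι]

open Classical in
/-- The set of elements related to some element of `X`. -/
noncomputable def relImage (R : ι → ι → Prop) (X : Finset ι) : Finset ι :=
  Finset.univ.filter fun j => ∃ i ∈ X, R i j

/-- Hall's condition with surplus one for all nonempty proper subsets. -/
def StrictHall (R : ι → ι → Prop) : Prop :=
  ∀ X : Finset ι, X.Nonempty → X ≠ Finset.univ → X.card < (relImage R X).card

/-- `R` satisfies `StrictHall`, and no longer does once any related pair is dropped. -/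
def MinStrictHall (R : ι → ι → Prop) : Prop :=
  StrictHall R ∧ ∀ i j, R i j → ¬ StrictHall fun k l => R k l ∧ ¬ (k = i ∧ l = j)

lemma mem_relImage {R : ι → ι → Prop} {X : Finset ι} {j : ι} :
    j ∈ relImage R X ↔ ∃ i ∈ X, R i j := by
  simp [relImage]

lemma StrictHall.mono {R Q : ι → ι → Prop} (hQ : StrictHall Q) (h : ∀ i j, Q i j → R i j) :
    StrictHall R := fun X hX hX' =>
  (hQ X hX hX').trans_le <| Finset.card_le_card fun j hj => by
    obtain ⟨i, hi, hij⟩ := mem_relImage.1 hj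
    exact mem_relImage.2 ⟨i, hi, h i j hij⟩

lemma StrictHall.cutStrong {R : ι → ι → Prop} (h : StrictHall R) : CutStrong R := by
  classical
  intro X hX hX'
  by_contra! hcon
  have hlt := h X.toFinset (by simpa using hX) (by simpa using hX')
  refine absurd (Finset.card_le_card (s := relImage R X.toFinset) (t := X.toFinset) ?_) hlt.not_ge
  intro j hj
  obtain ⟨i, hi, hij⟩ := mem_relImage.1 hj
  by_contra hjX
  exact hcon i (by simpa using hi) j (by simpa using hjX) hij

lemma CutStrong.strictHall {R : ι → ι → Prop} (hR : ∀ i, R i i) (h : CutStrong R) :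
    StrictHall R := by
  intro X hX hX'
  obtain ⟨i, hi, j, hj, hij⟩ := h X (by simpa using hX) (by simpa using hX')
  refine Finset.card_lt_card ⟨fun k hk => mem_relImage.2 ⟨k, hk, hR k⟩, fun hsub => hj ?_⟩
  exact hsub (mem_relImage.2 ⟨i, hi, hij⟩)

lemma MinStrictHall.of_le {R Q : ι → ι → Prop} (h : MinStrictHall R) (hQ : StrictHall Q)
    (hle : ∀ i j, Q i j → R i j) {i j : ι} (hij : R i j) : Q i j := by
  by_contra hn
  refine h.2 i j hij (hQ.mono fun k l hkl => ⟨hle k l hkl, ?_⟩)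
  rintro ⟨rfl, rfl⟩
  exact hn hkl

lemma StrictHall.comp_equiv {R : ι → ι → Prop} (h : StrictHall R) (τ : ι ≃ ι) :
    StrictHall fun i j => R i (τ j) := by
  intro X hX hX'
  refine (h X hX hX').trans_eq (Finset.card_bij (fun j _ => τ.symm j) ?_ ?_ ?_)
  · intro j hj
    simpa [mem_relImage] using hj
  · intro _ _ _ _ hjk
    exact τ.symm.injective hjk
  · intro j hj
    exact ⟨τ j, by simpa [mem_relImage] using hj, by simp⟩

lemma MinStrictHall.comp_equiv {R : ι → ι → Prop} (h : MinStrictHall R) (τ : ι ≃ ι) :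
    MinStrictHall fun i j => R i (τ j) := by
  refine ⟨h.1.comp_equiv τ, fun i j hij hS => h.2 i (τ j) hij ?_⟩
  refine (hS.comp_equiv τ.symm).mono fun k l hkl => ?_
  simpa [Equiv.symm_apply_eq] using hkl

/-- If the arcs `F` are strongly connecting on `S` and few, then a minimal relation has few
pairs: join the elements outside `S` to `S` by an in-branching and an out-branching. -/
lemma MinStrictHall.ncard_le_of_core {R : ι → ι → Prop} (hmin : MinStrictHall R)
    (hrefl : ∀ i, R i i) (S : Finset ι) (F : Finset (ι × ι)) (hFR : ∀ p ∈ F, R p.1 p.2)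
    (hcard : F.card + 3 ≤ 2 * S.card)
    (hF : ∀ X : Set ι, (∃ x ∈ S, x ∈ X) → (∀ p ∈ F, p.1 ∈ X → p.2 ∈ X) → ∀ x ∈ S, x ∈ X) :
    {p : ι × ι | R p.1 p.2}.ncard + 3 ≤ 3 * Fintype.card ι := by
  classical
  have hS : (S : Set ι).Nonempty := by
    rw [Finset.coe_nonempty, ← Finset.card_pos]; omega
  have hstrong := hmin.1.cutStrong
  obtain ⟨d, f, hf⟩ := hstrong.exists_rank hS
  obtain ⟨d', g, hg⟩ := hstrong.flip.exists_rank hS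
  let F' : Finset (ι × ι) := F ∪ (Sᶜ.image fun x => (x, f x)) ∪ (Sᶜ.image fun x => (g x, x))
  let Q : ι → ι → Prop := fun i j => i = j ∨ (i, j) ∈ F'
  have hQR : ∀ i j, Q i j → R i j := by
    rintro i j (rfl | hij)
    · exact hrefl i
    · simp only [F', Finset.mem_union, Finset.mem_image, Finset.mem_compl, Prod.mk.injEq] at hij
      rcases hij with (hij | ⟨x, hx, rfl, rfl⟩) | ⟨x, hx, rfl, rfl⟩
      · exact hFR _ hij
      · exact (hf x (by simpa using hx)).1
      · exact (hg x (by simpa using hx)).1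
  have hQ : CutStrong Q := by
    intro X ⟨x₀, hx₀⟩ hX'
    by_contra! hcon
    have hclosed : ∀ p ∈ F', p.1 ∈ X → p.2 ∈ X := by
      intro p hp h1
      by_contra h2
      exact hcon _ h1 _ h2 (Or.inr hp)
    have hmeet : ∀ n, ∀ x ∈ X, d x = n → ∃ x ∈ S, x ∈ X := by
      intro n
      induction n using Nat.strong_induction_on with
      | _ n ih =>
        intro x hx hn
        by_cases hxS : x ∈ S
        · exact ⟨x, hxS, hx⟩
        · refine ih (d (f x)) (hn ▸ (hf x (by simpa using hxS)).2) (f x) ?_ rfl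
          refine hclosed (x, f x) ?_ hx
          simp only [F', Finset.mem_union, Finset.mem_image, Finset.mem_compl]
          exact Or.inl (Or.inr ⟨x, hxS, rfl⟩)
    have hSX := hF X (hmeet _ x₀ hx₀ rfl) fun p hp =>
      hclosed p (Finset.mem_union_left _ (Finset.mem_union_left _ hp))
    have hall : ∀ n, ∀ x, d' x = n → x ∈ X := by
      intro n
      induction n using Nat.strong_induction_on with
      | _ n ih =>
        intro x hn
        by_cases hxS : x ∈ S
        · exact hSX x hxS
        · refine hclosed (g x, x) ?_ (ih (d' (g x)) (hn ▸ (hg x (by simpa using hxS)).2) _ rfl)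
          simp only [F', Finset.mem_union, Finset.mem_image, Finset.mem_compl]
          exact Or.inr ⟨x, hxS, rfl⟩
    exact hX' (Set.eq_univ_of_forall fun x => hall _ x rfl)
  have hsub : {p : ι × ι | R p.1 p.2} ⊆
      ((Finset.univ.image fun i : ι => (i, i)) ∪ F' : Finset (ι × ι)) := by
    rintro ⟨i, j⟩ hij
    have := hmin.of_le (hQ.strictHall fun i => Or.inl rfl) hQR hij
    rcases this with h | h
    · simp [show i = j from h]
    · exact Finset.mem_coe.2 (Finset.mem_union_right _ h)
  have h1 := Set.ncard_le_ncard hsub (Finset.finite_toSet _)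
  rw [Set.ncard_coe_finset] at h1
  have h2 := Finset.card_union_le (Finset.univ.image fun i : ι => (i, i)) F'
  have h3 : (Finset.univ.image fun i : ι => (i, i)).card ≤ Fintype.card ι := Finset.card_image_le
  have h4 := Finset.card_union_le (F ∪ Sᶜ.image fun x => (x, f x)) (Sᶜ.image fun x => (g x, x))
  have h5 := Finset.card_union_le F (Sᶜ.image fun x => (x, f x))
  have h6 : (Sᶜ.image fun x => (x, f x)).card ≤ Sᶜ.card := Finset.card_image_le
  have h7 : (Sᶜ.image fun x => (g x, x)).card ≤ Sᶜ.card := Finset.card_image_le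
  have h8 := Finset.card_add_card_compl S
  change F'.card ≤ _ at h4
  omega

/-- An arc without reverse lies on a directed cycle of length at least three. -/
lemma MinStrictHall.ncard_le_of_asymm {R : ι → ι → Prop} (hmin : MinStrictHall R)
    (hrefl : ∀ i, R i i) {u v : ι} (huv : R u v) (hvu : ¬ R v u) :
    {p : ι × ι | R p.1 p.2}.ncard + 3 ≤ 3 * Fintype.card ι := by
  classical
  obtain ⟨d, f, hf⟩ := hmin.1.cutStrong.exists_rank (Set.singleton_nonempty u)
  have hne : v ≠ u := by rintro rfl; exact hvu (hrefl _)
  let g : ι → ι := fun x => if x = u then v else f x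
  have hgu : g u = v := if_pos rfl
  have hg : ∀ x, x ≠ u → R x (g x) ∧ d (g x) < d x := by
    intro x hx
    simp only [g, if_neg hx]
    exact hf x hx
  let S : Finset ι := Finset.univ.filter fun x => ∃ k, g^[k] u = x
  have hS : ∀ x, x ∈ S ↔ ∃ k, g^[k] u = x := by simp [S]
  have hSg : ∀ x ∈ S, g x ∈ S := by
    intro x hx
    obtain ⟨k, rfl⟩ := (hS x).1 hx
    exact (hS _).2 ⟨k + 1, Function.iterate_succ_apply' g k u⟩
  have huS : u ∈ S := (hS u).2 ⟨0, rfl⟩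
  have hvS : v ∈ S := hgu ▸ hSg u huS
  refine hmin.ncard_le_of_core hrefl S (S.image fun x => (x, g x)) ?_ ?_ ?_
  · intro p hp
    obtain ⟨x, -, rfl⟩ := Finset.mem_image.1 hp
    by_cases hx : x = u
    · subst hx; exact hgu ▸ huv
    · exact (hg x hx).1
  · have h1 : (S.image fun x => (x, g x)).card ≤ S.card := Finset.card_image_le
    have h2 : ({u, v, g v} : Finset ι).card ≤ S.card := by
      refine Finset.card_le_card ?_
      simp [Finset.insert_subset_iff, huS, hvS, hSg v hvS]
    have h3 : ({u, v, g v} : Finset ι).card = 3 := by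
      refine Finset.card_eq_three.2 ⟨u, v, g v, hne.symm, ?_, ?_, rfl⟩
      · intro h; exact hvu (h ▸ (hg v hne).1)
      · intro h; exact (hg v hne).2.ne (congrArg d h.symm)
    omega
  · rintro X ⟨x, hxS, hxX⟩ hX
    have hstep : ∀ y ∈ S, y ∈ X → g y ∈ X := fun y hy hyX =>
      hX (y, g y) (Finset.mem_image_of_mem _ hy) hyX
    have hu : ∀ n, ∀ y ∈ S, y ∈ X → d y = n → u ∈ X := by
      intro n
      induction n using Nat.strong_induction_on with
      | _ n ih =>
        intro y hy hyX hn
        by_cases hyu : y = u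
        · exact hyu ▸ hyX
        · exact ih _ (hn ▸ (hg y hyu).2) (g y) (hSg y hy) (hstep y hy hyX) rfl
    have huX := hu _ x hxS hxX rfl
    intro y hy
    obtain ⟨k, rfl⟩ := (hS y).1 hy
    clear hy
    induction k with
    | zero => exact huX
    | succ k ih =>
      rw [Function.iterate_succ_apply']
      exact hstep _ ((hS _).2 ⟨k, rfl⟩) ih

lemma MinStrictHall.ncard_le_of_triangle {R : ι → ι → Prop} (hmin : MinStrictHall R)
    (hrefl : ∀ i, R i i) {u v w : ι} (h1 : u ≠ v) (h2 : u ≠ w) (h3 : v ≠ w)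
    (huv : R u v) (hvw : R v w) (hwu : R w u) :
    {p : ι × ι | R p.1 p.2}.ncard + 3 ≤ 3 * Fintype.card ι := by
  classical
  refine hmin.ncard_le_of_core hrefl {u, v, w} {(u, v), (v, w), (w, u)} ?_ ?_ ?_
  · simp [huv, hvw, hwu]
  · have : ({u, v, w} : Finset ι).card = 3 := Finset.card_eq_three.2 ⟨u, v, w, h1, h2, h3, rfl⟩
    have := Finset.card_le_three (a := (u, v)) (b := (v, w)) (c := (w, u))
    omega
  · intro X hx hX
    simp only [Finset.mem_insert, Finset.mem_singleton, forall_eq_or_imp, forall_eq,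
      exists_eq_or_imp, exists_eq_left] at hx hX ⊢
    tauto

theorem MinStrictHall.ncard_le {R : ι → ι → Prop} (hmin : MinStrictHall R)
    (hrefl : ∀ i, R i i) (hcard : 3 ≤ Fintype.card ι) :
    {p : ι × ι | R p.1 p.2}.ncard + 3 ≤ 3 * Fintype.card ι := by
  classical
  by_cases hsymm : ∀ u v, R u v → R v u
  swap
  · push Not at hsymm
    obtain ⟨u, v, huv, hvu⟩ := hsymm
    exact hmin.ncard_le_of_asymm hrefl huv hvu
  obtain ⟨u, v, w, h1, h2, h3, huv, hvw⟩ :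
      ∃ u v w, u ≠ v ∧ u ≠ w ∧ v ≠ w ∧ R u v ∧ R v w := by
    have hstrong := hmin.1.cutStrong
    have hproper : ∀ s : Finset ι, s.card ≤ 2 → (s : Set ι) ≠ Set.univ := by
      intro s hs h
      rw [Finset.coe_eq_univ] at h
      rw [h, Finset.card_univ] at hs
      omega
    obtain ⟨x⟩ : Nonempty ι := Fintype.card_pos_iff.1 (by omega)
    obtain ⟨x', hx', y, hy, hxy⟩ := hstrong ({x} : Finset ι) (by simp) (hproper _ (by simp))
    obtain rfl : x' = x := by simpa using hx'
    obtain ⟨z, hz, w, hw, hzw⟩ := hstrong ({x', y} : Finset ι) (by simp)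
      (hproper _ Finset.card_le_two)
    have hy' : y ≠ x' := by simpa using hy
    have hw' : w ≠ x' ∧ w ≠ y := by simpa using hw
    have hz' : z = x' ∨ z = y := by simpa using hz
    rcases hz' with rfl | rfl
    · exact ⟨y, z, w, hy', hw'.2.symm, hw'.1.symm, hsymm _ _ hxy, hzw⟩
    · exact ⟨x', z, w, hy'.symm, hw'.1.symm, hw'.2.symm, hxy, hzw⟩
  let τ := Equiv.swap u v
  have hu : τ u = v := Equiv.swap_apply_left u v
  have hv : τ v = u := Equiv.swap_apply_right u v
  have hτ : ∀ x, x ≠ u → x ≠ v → τ x = x := fun x => Equiv.swap_apply_of_ne_of_ne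
  have hrefl' : ∀ i, R i (τ i) := by
    intro i
    by_cases hiu : i = u
    · subst hiu; rwa [hu]
    by_cases hiv : i = v
    · subst hiv; rw [hv]; exact hsymm _ _ huv
    · rw [hτ i hiu hiv]; exact hrefl i
  refine le_trans (Nat.add_le_add_right ?_ 3)
    ((hmin.comp_equiv τ).ncard_le_of_triangle hrefl' h1 h2 h3 ?_ ?_ ?_)
  · refine Set.ncard_le_ncard_of_injOn (fun p => (p.1, τ.symm p.2)) ?_ ?_ (Set.toFinite _)
    · rintro ⟨i, j⟩ hij
      simpa using hij
    · rintro ⟨i, j⟩ - ⟨k, l⟩ - h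
      simpa using h
  · rw [hv]; exact hrefl u
  · rw [hτ w h2.symm h3.symm]; exact hvw
  · rw [hu]; exact hsymm _ _ hvw

lemma strictHall_of_covered {f : ι ⊕ ι ≃ V} (hf : IsBipartitionBy G f) (hG : G.Connected)
    (hcov : ∀ e ∈ G.edgeSet, ∃ M : G.Subgraph, M.IsPerfectMatching ∧ e ∈ M.edgeSet) :
    StrictHall (crossRel G f) := by
  classical
  intro X ⟨x₀, hx₀⟩ hX
  by_contra! hcon
  obtain ⟨z, hz⟩ : ∃ z, z ∉ X := by simpa [Finset.eq_univ_iff_forall] using hX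
  let C : Set V := {v | ∀ s, f s = v → Sum.elim (· ∈ X) (· ∈ relImage (crossRel G f) X) s}
  have hCl : ∀ i, f (.inl i) ∈ C ↔ i ∈ X := fun i => by simp [C]
  have hCr : ∀ j, f (.inr j) ∈ C ↔ j ∈ relImage (crossRel G f) X := fun j => by simp [C]
  obtain ⟨x, hx, y, hy, hxy⟩ := exists_adj_boundary hG ((hCl x₀).2 hx₀) (mt (hCl z).1 hz)
  obtain ⟨i, j, hi, hj, hij⟩ :
      ∃ i j, i ∉ X ∧ j ∈ relImage (crossRel G f) X ∧ crossRel G f i j := by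
    obtain ⟨i | i, rfl⟩ := f.surjective x <;> obtain ⟨j | j, rfl⟩ := f.surjective y
    · exact absurd hxy (hf i j).1
    · exact absurd ((hCr j).2 (mem_relImage.2 ⟨i, (hCl i).1 hx, hxy⟩)) hy
    · exact ⟨j, i, mt (hCl j).2 hy, (hCr i).1 hx, hxy.symm⟩
    · exact absurd hxy (hf i j).2
  obtain ⟨M, hM, hMe⟩ := hcov s(f (.inl i), f (.inr j)) hij
  obtain ⟨σ, hσ, hσM⟩ := hf.exists_injective hM
  have hle : ((insert i X).image σ).card ≤ (relImage (crossRel G f) X).card := by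
    refine Finset.card_le_card fun k hk => ?_
    obtain ⟨l, hl, rfl⟩ := Finset.mem_image.1 hk
    rcases Finset.mem_insert.1 hl with rfl | hl
    · rwa [(hσM l j).1 hMe]
    · exact mem_relImage.2 ⟨l, hl, M.adj_sub ((hσM l _).2 rfl)⟩
  rw [Finset.card_image_of_injective _ hσ, Finset.card_insert_of_notMem hi] at hle
  omega

lemma StrictHall.card_le {R : ι → ι → Prop} (h : StrictHall R) (hcard : 2 ≤ Fintype.card ι)
    (X : Finset ι) : X.card ≤ (relImage R X).card := by
  classical
  rcases X.eq_empty_or_nonempty with rfl | hX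
  · simp
  by_cases hX' : X = Finset.univ
  · obtain ⟨i, hi⟩ := hX
    have herase : (X.erase i).card = X.card - 1 := Finset.card_erase_of_mem hi
    have hXc : X.card = Fintype.card ι := hX' ▸ Finset.card_univ
    have h1 := h (X.erase i) (Finset.card_pos.1 (by omega))
      (fun he => Finset.notMem_erase i X (he ▸ Finset.mem_univ i))
    have h2 : (relImage R (X.erase i)).card ≤ (relImage R X).card := by
      refine Finset.card_le_card fun j hj => ?_
      obtain ⟨k, hk, hkj⟩ := mem_relImage.1 hj
      exact mem_relImage.2 ⟨k, Finset.mem_of_mem_erase hk, hkj⟩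
    omega
  · exact (h X hX hX').le

lemma StrictHall.connected {f : ι ⊕ ι ≃ V} (hH : StrictHall (crossRel G f))
    (hcard : 2 ≤ Fintype.card ι) : G.Connected := by
  classical
  have : Nonempty ι := Fintype.card_pos_iff.1 (by omega)
  have : Nonempty V := ⟨f (.inl (Classical.arbitrary ι))⟩
  refine ⟨fun u v => ?_⟩
  let X : Finset ι := Finset.univ.filter fun i => G.Reachable u (f (.inl i))
  let Y : Finset ι := Finset.univ.filter fun i => G.Reachable u (f (.inr i))
  have hX : ∀ i, i ∈ X ↔ G.Reachable u (f (.inl i)) := by simp [X]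
  have hY : ∀ i, i ∈ Y ↔ G.Reachable u (f (.inr i)) := by simp [Y]
  have hXY : relImage (crossRel G f) X ⊆ Y := by
    intro j hj
    obtain ⟨i, hi, hij⟩ := mem_relImage.1 hj
    exact (hY j).2 (((hX i).1 hi).trans (SimpleGraph.Adj.reachable hij))
  have hXY' : relImage (crossRel G f) Xᶜ ⊆ Yᶜ := by
    intro j hj
    obtain ⟨i, hi, hij⟩ := mem_relImage.1 hj
    rw [Finset.mem_compl] at hi ⊢
    exact fun hjY => hi ((hX i).2 (((hY j).1 hjY).trans (Adj.reachable (SimpleGraph.Adj.symm hij))))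
  have h1 := Finset.card_le_card hXY
  have h2 := Finset.card_le_card hXY'
  have h3 := hH.card_le hcard X
  have h4 := hH.card_le hcard Xᶜ
  have h5 := Finset.card_add_card_compl X
  have h6 := Finset.card_add_card_compl Y
  rcases X.eq_empty_or_nonempty with hX0 | hXne
  · have hY0 : Y = ∅ := by
      rw [← Finset.card_eq_zero] at hX0 ⊢
      omega
    obtain ⟨i | i, rfl⟩ := f.surjective u
    · exact absurd ((hX i).2 (Reachable.refl _)) (by simp [hX0])
    · exact absurd ((hY i).2 (Reachable.refl _)) (by simp [hY0])
  by_cases hX1 : X = Finset.univ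
  · have hY1 : Y = Finset.univ := by
      rw [← Finset.card_eq_iff_eq_univ]
      rw [hX1, Finset.card_univ] at h3 h5
      have := Finset.card_le_univ Y
      rw [hX1] at h1
      omega
    obtain ⟨i | i, rfl⟩ := f.surjective v
    · exact (hX i).1 (by simp [hX1])
    · exact (hY i).1 (by simp [hY1])
  · have := hH X hXne hX1
    omega

/-- Under `StrictHall` every related pair extends to a permutation inside the relation. -/
lemma StrictHall.exists_perm {R : ι → ι → Prop} (h : StrictHall R) {i₀ j₀ : ι} (hij : R i₀ j₀) :
    ∃ σ : ι ≃ ι, σ i₀ = j₀ ∧ ∀ i, R i (σ i) := by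
  classical
  let Q : {i // i ≠ i₀} → ι → Prop := fun i j => R i j ∧ j ≠ j₀
  obtain ⟨g, hg, hgQ⟩ := (Fintype.all_card_le_filter_rel_iff_exists_injective Q).1 (by
    intro A
    rcases A.eq_empty_or_nonempty with rfl | hA
    · simp
    have hlt := h (A.image Subtype.val) (hA.image _) (by
      intro he
      have := he ▸ Finset.mem_univ i₀
      simp at this)
    rw [Finset.card_image_of_injective _ Subtype.val_injective] at hlt
    have hsub : (relImage R (A.image Subtype.val)).erase j₀ ⊆
        Finset.univ.filter fun b => ∃ a ∈ A, Q a b := by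
      intro j hj
      obtain ⟨hj0, hj⟩ := Finset.mem_erase.1 hj
      obtain ⟨i, hi, hij⟩ := mem_relImage.1 hj
      obtain ⟨a, ha, rfl⟩ := Finset.mem_image.1 hi
      exact Finset.mem_filter.2 ⟨Finset.mem_univ _, a, ha, hij, hj0⟩
    have h1 := Finset.card_le_card hsub
    have h2 := Finset.pred_card_le_card_erase (s := relImage R (A.image Subtype.val)) (a := j₀)
    omega)
  let s : ι → ι := fun i => if hi : i = i₀ then j₀ else g ⟨i, hi⟩
  have hs0 : s i₀ = j₀ := dif_pos rfl
  have hs1 : ∀ i (hi : i ≠ i₀), s i = g ⟨i, hi⟩ := fun i hi => dif_neg hi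
  have hs : s.Injective := by
    intro i k hik
    by_cases hi : i = i₀ <;> by_cases hk : k = i₀
    · rw [hi, hk]
    · subst hi
      rw [hs0, hs1 k hk] at hik
      exact absurd hik.symm (hgQ _).2
    · subst hk
      rw [hs0, hs1 i hi] at hik
      exact absurd hik (hgQ _).2
    · rw [hs1 i hi, hs1 k hk] at hik
      simpa using hg hik
  refine ⟨Equiv.ofBijective s (Finite.injective_iff_bijective.1 hs), hs0, fun i => ?_⟩
  change R i (s i)
  by_cases hi : i = i₀
  · subst hi; rwa [hs0]
  · rw [hs1 i hi]; exact (hgQ ⟨i, hi⟩).1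

lemma StrictHall.covered {f : ι ⊕ ι ≃ V} (hf : IsBipartitionBy G f)
    (hH : StrictHall (crossRel G f)) :
    ∀ e ∈ G.edgeSet, ∃ M : G.Subgraph, M.IsPerfectMatching ∧ e ∈ M.edgeSet := by
  have key : ∀ i j, G.Adj (f (.inl i)) (f (.inr j)) →
      ∃ M : G.Subgraph, M.IsPerfectMatching ∧ M.Adj (f (.inl i)) (f (.inr j)) := by
    intro i j hij
    obtain ⟨σ, rfl, hσ⟩ := hH.exists_perm hij
    obtain ⟨M, hM, hMσ⟩ := exists_perfectMatching_of_perm f σ hσ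
    exact ⟨M, hM, hMσ i⟩
  intro e
  induction e with
  | _ u v =>
    intro huv
    obtain ⟨i | i, rfl⟩ := f.surjective u <;> obtain ⟨j | j, rfl⟩ := f.surjective v
    · exact absurd huv (hf i j).1
    · exact key i j huv
    · obtain ⟨M, hM, h⟩ := key j i huv.symm
      exact ⟨M, hM, h.symm⟩
    · exact absurd huv (hf i j).2

lemma card_eq_two_mul [Fintype V] (f : ι ⊕ ι ≃ V) : Fintype.card V = 2 * Fintype.card ι := by
  rw [← Fintype.card_congr f, Fintype.card_sum, two_mul]

lemma matchingCovered_iff_strictHall [Fintype V] {f : ι ⊕ ι ≃ V} (hf : IsBipartitionBy G f)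
    (hcard : 2 ≤ Fintype.card ι) : MatchingCovered G ↔ StrictHall (crossRel G f) :=
  ⟨fun h => strictHall_of_covered hf h.1 h.2.2, fun h =>
    ⟨h.connected hcard, by rw [card_eq_two_mul f]; omega, h.covered hf⟩⟩

lemma minStrictHall_of_minimal [Fintype V] {f : ι ⊕ ι ≃ V} (hf : IsBipartitionBy G f)
    (hcard : 2 ≤ Fintype.card ι) (hG : MinimalMatchingCovered G) :
    MinStrictHall (crossRel G f) := by
  refine ⟨(matchingCovered_iff_strictHall hf hcard).1 hG.1, fun i j hij hS => ?_⟩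
  refine hG.2 s(f (.inl i), f (.inr j)) hij ?_
  refine (matchingCovered_iff_strictHall (f := f) (fun k l => ?_) hcard).2 ?_
  · exact ⟨fun h => (hf k l).1 (deleteEdges_le _ h), fun h => (hf k l).2 (deleteEdges_le _ h)⟩
  · convert hS using 3 with k l
    simp [crossRel, deleteEdges_adj]

lemma ncard_edgeSet_le {f : ι ⊕ ι ≃ V} (hf : IsBipartitionBy G f) :
    G.edgeSet.ncard ≤ {p : ι × ι | crossRel G f p.1 p.2}.ncard := by
  have hsub : G.edgeSet ⊆
      (fun p : ι × ι => s(f (.inl p.1), f (.inr p.2))) '' {p | crossRel G f p.1 p.2} := by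
    intro e
    induction e with
    | _ u v =>
      intro huv
      obtain ⟨i | i, rfl⟩ := f.surjective u <;> obtain ⟨j | j, rfl⟩ := f.surjective v
      · exact absurd huv (hf i j).1
      · exact ⟨(i, j), huv, rfl⟩
      · exact ⟨(j, i), huv.symm, Sym2.eq_swap⟩
      · exact absurd huv (hf i j).2
  exact (Set.ncard_le_ncard hsub (Set.toFinite _)).trans (Set.ncard_image_le (Set.toFinite _))

lemma nonempty_iso_cycleGraph_four {f : ι ⊕ ι ≃ V} (hf : IsBipartitionBy G f)
    (hH : StrictHall (crossRel G f)) (hcard : Fintype.card ι = 2) :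
    Nonempty (G ≃g cycleGraph 4) := by
  classical
  have hall : ∀ i j, G.Adj (f (.inl i)) (f (.inr j)) := by
    intro i j
    have h1 := hH {i} (by simp) fun h => by
      have := congrArg Finset.card h
      rw [Finset.card_univ, Finset.card_singleton] at this
      omega
    have h2 : relImage (crossRel G f) {i} = Finset.univ := by
      rw [← Finset.card_eq_iff_eq_univ]
      have := Finset.card_le_univ (relImage (crossRel G f) {i})
      rw [Finset.card_singleton] at h1
      omega
    have h3 := h2 ▸ Finset.mem_univ j
    simpa [mem_relImage, crossRel] using h3
  let e : Fin 2 ≃ ι := (Fintype.equivFinOfCardEq hcard).symm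
  let t : Fin 4 ≃ Fin 2 ⊕ Fin 2 :=
    { toFun := ![.inl 0, .inr 0, .inl 1, .inr 1]
      invFun := Sum.elim ![0, 2] ![1, 3]
      left_inv := by decide
      right_inv := by decide }
  have ht : ∀ x y, (cycleGraph 4).Adj x y ↔ (t x).isLeft ≠ (t y).isLeft := by decide
  let φ : Fin 4 ≃ V := t.trans ((Equiv.sumCongr e e).trans f)
  refine ⟨(⟨φ, fun {x y} => ?_⟩ : cycleGraph 4 ≃g G).symm⟩
  rw [ht]
  change G.Adj (f (Equiv.sumCongr e e (t x))) (f (Equiv.sumCongr e e (t y))) ↔ _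
  rcases t x with i | i <;> rcases t y with j | j
  · simpa using (hf (e i) (e j)).1
  · simpa using hall (e i) (e j)
  · simpa using (hall (e j) (e i)).symm
  · simpa using (hf (e i) (e j)).2

end BipartiteCover

/-- A minimal bipartite matching covered graph, other than the 4-cycle, has at most
`(3n - 6)/2` edges. -/
theorem stmt3 {V : Type*} [Fintype V] (G : SimpleGraph V)
    (hbip : G.Colorable 2) (hmin : MinimalMatchingCovered G)
    (hC4 : IsEmpty (G ≃g cycleGraph 4)) :
    2 * G.edgeSet.ncard + 6 ≤ 3 * Fintype.card V := by
  classical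
  obtain ⟨hconn, hcard, hcov⟩ := hmin.1
  have : Nontrivial V := Fintype.one_lt_card_iff_nontrivial.1 (by omega)
  obtain ⟨w, hw⟩ := hconn.preconnected.exists_adj_of_nontrivial (Classical.arbitrary V)
  obtain ⟨M, hM, -⟩ := hcov s(_, w) hw
  obtain ⟨A, f, hf, hrefl⟩ := BipartiteCover.exists_isBipartitionBy hbip hM
  have hVA := BipartiteCover.card_eq_two_mul f
  have hH := BipartiteCover.minStrictHall_of_minimal hf (by omega) hmin
  have hA : Fintype.card A ≠ 2 := fun h =>
    hC4.elim (BipartiteCover.nonempty_iso_cycleGraph_four hf hH.1 h).some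
  have h1 := hH.ncard_le hrefl (by omega)
  have h2 := BipartiteCover.ncard_edgeSet_le hf
  omega
end

section
/- Let G be a minimal bipartite matching covered graph. Then the number of 2-edges of G is at least (n + 10)/6, i.e. 6·|E2| ≥ n + 10, where n is the number of vertices of G. -/
open SimpleGraph

/-- A 2-edge of `G`: an edge both of whose endpoints have degree exactly 2. -/
def IsTwoEdge {V : Type*} (G : SimpleGraph V) (e : Sym2 V) : Prop :=
  e ∈ G.edgeSet ∧ ∀ v ∈ e, degN G v = 2


namespace BipartiteEdges

variable {α β : Type*} [DecidableEq α] [DecidableEq β]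

/-- The set of neighbours of `X` in the bipartite graph with edge set `E`. -/
def nb (E : Finset (α × β)) (X : Finset α) : Finset β :=
  (E.filter (fun e => e.1 ∈ X)).image Prod.snd

/-- The degree of a vertex of the first colour class. -/
def degL (E : Finset (α × β)) (a : α) : ℕ := (E.filter (fun e => e.1 = a)).card

/-- The degree of a vertex of the second colour class. -/
def degR (E : Finset (α × β)) (b : β) : ℕ := (E.filter (fun e => e.2 = b)).card

/-- The edges joining two vertices of degree two. -/
def twoEdges (E : Finset (α × β)) : Finset (α × β) :=
  E.filter (fun e => degL E e.1 = 2 ∧ degR E e.2 = 2)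

/-- Hall's condition with surplus one: the bipartite graph is matching covered. -/
structure Surplus (A : Finset α) (B : Finset β) (E : Finset (α × β)) : Prop where
  sub : ∀ a b, (a, b) ∈ E → a ∈ A ∧ b ∈ B
  card_eq : A.card = B.card
  two_le : 2 ≤ A.card
  hall : ∀ X ⊆ A, X.Nonempty → X ≠ A → X.card < (nb E X).card

/-- `X` is a set of minimum surplus whose only edge to `b` comes from `a`. -/
structure Tight (A : Finset α) (E : Finset (α × β)) (a : α) (b : β) (X : Finset α) : Prop where
  sub : X ⊆ A
  mem : a ∈ X
  ne : X ≠ A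
  card_le : (nb E X).card ≤ X.card + 1
  unique : ∀ x ∈ X, (x, b) ∈ E → x = a

/-- A bipartite graph with surplus one, every edge of which is needed for that. -/
structure MinSurplus (A : Finset α) (B : Finset β) (E : Finset (α × β)) : Prop
    extends Surplus A B E where
  tight : ∀ a b, (a, b) ∈ E → ∃ X, Tight A E a b X

variable {A : Finset α} {B : Finset β} {E : Finset (α × β)}

@[simp] theorem mem_nb {X : Finset α} {b : β} : b ∈ nb E X ↔ ∃ a ∈ X, (a, b) ∈ E := by
  simp [nb, and_comm]

theorem nb_union (X Y : Finset α) : nb E (X ∪ Y) = nb E X ∪ nb E Y := by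
  ext b; simp only [mem_nb, Finset.mem_union]; grind

theorem nb_inter_subset (X Y : Finset α) : nb E (X ∩ Y) ⊆ nb E X ∩ nb E Y := by
  intro b; simp only [mem_nb, Finset.mem_inter]; grind

theorem card_nb_singleton (a : α) : (nb E {a}).card = degL E a := by
  unfold nb degL
  rw [Finset.card_image_of_injOn]
  · simp
  · rintro ⟨x, y⟩ hx ⟨x', y'⟩ hx' h
    simp at hx hx' h
    simp [hx.2, hx'.2, h]

theorem Surplus.nb_subset (h : Surplus A B E) (X : Finset α) : nb E X ⊆ B := by
  intro b hb
  obtain ⟨a, -, hab⟩ := mem_nb.1 hb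
  exact (h.sub a b hab).2

theorem Surplus.two_le_degL (h : Surplus A B E) {a : α} (ha : a ∈ A) : 2 ≤ degL E a := by
  have := h.hall {a} (by simpa) (by simp) (by
    intro h'
    have := h.two_le
    simp [← h'] at this)
  rwa [card_nb_singleton, Finset.card_singleton] at this

theorem Surplus.exists_ne_adj (h : Surplus A B E) {b : β} (hb : b ∈ B) (a : α) :
    ∃ x, x ≠ a ∧ (x, b) ∈ E := by
  by_contra! hcon
  have h2 := h.two_le
  obtain ⟨c, hc, hac⟩ : ∃ c ∈ A, ∀ x, (x, b) ∈ E → x = c := by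
    by_cases ha : a ∈ A
    · exact ⟨a, ha, fun x hx => by_contra fun hxa => hcon x hxa hx⟩
    · obtain ⟨c, hc⟩ : A.Nonempty := Finset.card_pos.1 (by omega)
      exact ⟨c, hc, fun x hx => absurd hx (hcon x fun e => ha (e ▸ (h.sub x b hx).1))⟩
  have h1 := h.hall (A.erase c) (Finset.erase_subset _ _)
    (Finset.card_pos.1 (by rw [Finset.card_erase_of_mem hc]; omega))
    (fun e => by have := Finset.card_erase_of_mem hc; rw [e] at this; omega)
  have h3 : nb E (A.erase c) ⊆ B.erase b := by
    intro y hy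
    obtain ⟨x, hx, hxy⟩ := mem_nb.1 hy
    refine Finset.mem_erase.2 ⟨?_, (h.sub x y hxy).2⟩
    rintro rfl
    exact (Finset.mem_erase.1 hx).1 (hac x hxy)
  have h4 := Finset.card_le_card h3
  rw [Finset.card_erase_of_mem hc] at h1
  rw [Finset.card_erase_of_mem hb, ← h.card_eq] at h4
  omega

theorem Surplus.exists_adj (h : Surplus A B E) {b : β} (hb : b ∈ B) : ∃ x, (x, b) ∈ E := by
  obtain ⟨a, -⟩ : A.Nonempty := Finset.card_pos.1 (by have := h.two_le; omega)
  obtain ⟨x, -, hx⟩ := h.exists_ne_adj hb a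
  exact ⟨x, hx⟩

omit [DecidableEq α] in
theorem one_lt_degR {a a' : α} {b : β} (h : (a, b) ∈ E) (h' : (a', b) ∈ E) (hne : a ≠ a') :
    1 < degR E b :=
  Finset.one_lt_card.2 ⟨(a, b), by simpa, (a', b), by simpa, by simpa⟩

theorem Surplus.two_le_degR (h : Surplus A B E) {b : β} (hb : b ∈ B) : 2 ≤ degR E b := by
  obtain ⟨a, ha⟩ := h.exists_adj hb
  obtain ⟨x, hx, hxb⟩ := h.exists_ne_adj hb a
  exact one_lt_degR hxb ha hx

theorem Surplus.union_eq (h : Surplus A B E) {a : α} {b b' : β} {X X' : Finset α}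
    (hab : (a, b) ∈ E) (hab' : (a, b') ∈ E) (hne : b ≠ b') (hd : 3 ≤ degL E a)
    (hX : Tight A E a b X) (hX' : Tight A E a b' X') : X ∪ X' = A := by
  by_contra hU
  have hU1 := h.hall (X ∪ X') (Finset.union_subset hX.sub hX'.sub)
    ⟨a, Finset.mem_union_left _ hX.mem⟩ hU
  have e1 := Finset.card_union_add_card_inter X X'
  have e2 := Finset.card_union_add_card_inter (nb E X) (nb E X')
  rw [← nb_union] at e2
  have e3 := Finset.card_le_card (nb_inter_subset (E := E) X X')
  have c1 := hX.card_le
  have c2 := hX'.card_le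
  have ha : a ∈ X ∩ X' := Finset.mem_inter.2 ⟨hX.mem, hX'.mem⟩
  have hI : (nb E (X ∩ X')).card ≤ (X ∩ X').card + 1 := by omega
  have hsub : nb E ((X ∩ X').erase a) ⊆ ((nb E (X ∩ X')).erase b).erase b' := by
    intro y hy
    obtain ⟨x, hx, hxy⟩ := mem_nb.1 hy
    obtain ⟨hxa, hx⟩ := Finset.mem_erase.1 hx
    obtain ⟨hx1, hx2⟩ := Finset.mem_inter.1 hx
    refine Finset.mem_erase.2 ⟨?_, Finset.mem_erase.2 ⟨?_, mem_nb.2 ⟨x, hx, hxy⟩⟩⟩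
    · rintro rfl; exact hxa (hX'.unique x hx2 hxy)
    · rintro rfl; exact hxa (hX.unique x hx1 hxy)
  have hb : b ∈ nb E (X ∩ X') := mem_nb.2 ⟨a, ha, hab⟩
  have hb' : b' ∈ (nb E (X ∩ X')).erase b :=
    Finset.mem_erase.2 ⟨hne.symm, mem_nb.2 ⟨a, ha, hab'⟩⟩
  have hc := Finset.card_le_card hsub
  rw [Finset.card_erase_of_mem hb', Finset.card_erase_of_mem hb] at hc
  rcases ((X ∩ X').erase a).eq_empty_or_nonempty with h0 | h0
  · have : X ∩ X' = {a} := by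
      rcases (Finset.erase_eq_empty_iff _ _).1 h0 with h0 | h0
      · simp [h0] at ha
      · exact h0
    rw [this, card_nb_singleton] at hI
    simp at hI
    omega
  · have hJ := h.hall _ ((Finset.erase_subset _ _).trans
      (Finset.inter_subset_left.trans hX.sub)) h0
      (fun e => by
        have : a ∈ A := hX.sub hX.mem
        rw [← e] at this
        simp at this)
    rw [Finset.card_erase_of_mem ha] at hJ
    have := Finset.card_pos.2 ⟨a, ha⟩
    omega

theorem Surplus.disjoint (h : Surplus A B E) {a a' : α} {b : β} {X X' : Finset α}
    (hab : (a, b) ∈ E) (hab' : (a', b) ∈ E) (hne : a ≠ a') (hd : 3 ≤ degR E b)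
    (hX : Tight A E a b X) (hX' : Tight A E a' b X') : Disjoint X X' := by
  rw [Finset.disjoint_iff_inter_eq_empty]
  by_contra hI
  obtain ⟨⟨x, y⟩, hx⟩ : ((E.filter (fun e => e.2 = b)) \ {(a, b), (a', b)}).Nonempty := by
    rw [← Finset.card_pos]
    have := Finset.le_card_sdiff {(a, b), (a', b)} (E.filter (fun e => e.2 = b))
    have h2 := Finset.card_le_two (a := (a, b)) (b := (a', b))
    unfold degR at hd
    omega
  simp at hx
  obtain ⟨⟨hxy, rfl⟩, hxa, hxa'⟩ := hx
  have hxU : x ∉ X ∪ X' := by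
    intro hx
    rcases Finset.mem_union.1 hx with hx | hx
    · exact hxa (hX.unique x hx hxy) rfl
    · exact hxa' (hX'.unique x hx hxy) rfl
  have hU1 := h.hall (X ∪ X') (Finset.union_subset hX.sub hX'.sub)
    ⟨a, Finset.mem_union_left _ hX.mem⟩ (fun e => hxU (e ▸ (h.sub x y hxy).1))
  have hI1 := h.hall (X ∩ X') (Finset.inter_subset_left.trans hX.sub)
    (Finset.nonempty_iff_ne_empty.2 hI) (fun e => hX.ne (le_antisymm hX.sub (by
      rw [← e]; exact Finset.inter_subset_left)))
  have e1 := Finset.card_union_add_card_inter X X'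
  have e2 := Finset.card_union_add_card_inter (nb E X) (nb E X')
  rw [← nb_union] at e2
  have hsub : nb E (X ∩ X') ⊆ (nb E X ∩ nb E X').erase y := by
    intro z hz
    refine Finset.mem_erase.2 ⟨?_, nb_inter_subset _ _ hz⟩
    rintro rfl
    obtain ⟨w, hw, hwz⟩ := mem_nb.1 hz
    obtain ⟨hw1, hw2⟩ := Finset.mem_inter.1 hw
    exact hne ((hX.unique w hw1 hwz).symm.trans (hX'.unique w hw2 hwz))
  have hy : y ∈ nb E X ∩ nb E X' :=
    Finset.mem_inter.2 ⟨mem_nb.2 ⟨a, hX.mem, hab⟩, mem_nb.2 ⟨a', hX'.mem, hab'⟩⟩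
  have e3 := Finset.card_le_card hsub
  rw [Finset.card_erase_of_mem hy] at e3
  have := Finset.card_pos.2 ⟨y, hy⟩
  have c1 := hX.card_le
  have c2 := hX'.card_le
  omega

/-- A bipartite graph all of whose nonempty subgraphs have a vertex of degree one is a forest. -/
theorem card_lt_of_exists_leaf (S : Finset (α × β)) :
    ∀ (A : Finset α) (B : Finset β), (∀ a b, (a, b) ∈ S → a ∈ A ∧ b ∈ B) →
    0 < A.card + B.card →
    (∀ T ⊆ S, (∀ a b, (a, b) ∈ T →
      (∃ b', b' ≠ b ∧ (a, b') ∈ T) ∧ ∃ a', a' ≠ a ∧ (a', b) ∈ T) → T = ∅) →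
    S.card < A.card + B.card := by
  induction S using Finset.strongInduction with
  | H S ih =>
  intro A B hsub hpos hleaf
  rcases S.eq_empty_or_nonempty with rfl | hS
  · simpa using hpos
  have hex : ∃ a b, (a, b) ∈ S ∧
      ((∀ b', (a, b') ∈ S → b' = b) ∨ ∀ a', (a', b) ∈ S → a' = a) := by
    by_contra! hcon
    refine hS.ne_empty (hleaf S subset_rfl fun a b hab => ?_)
    obtain ⟨⟨b', hb', hbne⟩, a', ha', hane⟩ := hcon a b hab
    exact ⟨⟨b', hbne, hb'⟩, a', hane, ha'⟩
  obtain ⟨a, b, hab, hor⟩ := hex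
  obtain ⟨haA, hbB⟩ := hsub a b hab
  have hcS := Finset.card_erase_of_mem hab
  have hcA := Finset.card_erase_of_mem haA
  have hcB := Finset.card_erase_of_mem hbB
  have hpA := Finset.card_pos.2 ⟨a, haA⟩
  have hpB := Finset.card_pos.2 ⟨b, hbB⟩
  have hleaf' : ∀ T ⊆ S.erase (a, b), (∀ a b, (a, b) ∈ T →
      (∃ b', b' ≠ b ∧ (a, b') ∈ T) ∧ ∃ a', a' ≠ a ∧ (a', b) ∈ T) → T = ∅ :=
    fun T hT => hleaf T (hT.trans (Finset.erase_subset _ _))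
  rcases hor with hu | hu
  · have := ih (S.erase (a, b)) (Finset.erase_ssubset hab) (A.erase a) B (by
      intro x y hxy
      obtain ⟨hne, hxyS⟩ := Finset.mem_erase.1 hxy
      refine ⟨Finset.mem_erase.2 ⟨?_, (hsub x y hxyS).1⟩, (hsub x y hxyS).2⟩
      rintro rfl
      exact hne (by rw [hu y hxyS])) (by omega) hleaf'
    omega
  · have := ih (S.erase (a, b)) (Finset.erase_ssubset hab) A (B.erase b) (by
      intro x y hxy
      obtain ⟨hne, hxyS⟩ := Finset.mem_erase.1 hxy
      refine ⟨(hsub x y hxyS).1, Finset.mem_erase.2 ⟨?_, (hsub x y hxyS).2⟩⟩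
      rintro rfl
      exact hne (by rw [hu x hxyS])) (by omega) hleaf'
    omega

theorem MinSurplus.eq_empty_of_descent (h : MinSurplus A B E) (S : Finset (α × β))
    (X : α × β → Finset α)
    (hX : ∀ e ∈ S, Tight A E e.1 e.2 (X e)) (hSE : S ⊆ E) (P : α × β → Prop)
    (hmono : ∀ e ∈ S, ∀ f ∈ S, P e → X f ⊆ X e → P f)
    (hstep : ∀ a b, (a, b) ∈ S → P (a, b) → 3 ≤ degL E a ∧ ∃ b', b' ≠ b ∧ (a, b') ∈ S ∧
      (X (a, b) ∪ X (a, b') = A → 3 ≤ degR E b' ∧ ∃ a', a' ≠ a ∧ (a', b') ∈ S)) :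
    ∀ e ∈ S, ¬ P e := by
  suffices H : ∀ k, ∀ e ∈ S, (X e).card = k → ¬ P e from fun e he => H _ e he rfl
  intro k
  induction k using Nat.strong_induction_on with
  | _ k ih =>
  rintro ⟨a, b⟩ he hk hP
  obtain ⟨hda, b', hbb', hab', hrest⟩ := hstep a b he hP
  have hU := h.union_eq (hSE he) (hSE hab') hbb'.symm hda (hX _ he) (hX _ hab')
  obtain ⟨hdb, a', haa', hab''⟩ := hrest hU
  have hD := h.disjoint (hSE hab'') (hSE hab') haa' hdb (hX _ hab'') (hX _ hab')
  have hss : X (a', b') ⊆ X (a, b) := by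
    intro x hx
    have hxA := (hX _ hab'').sub hx
    rw [← hU] at hxA
    rcases Finset.mem_union.1 hxA with hx' | hx'
    · exact hx'
    · exact absurd hx' (Finset.disjoint_left.1 hD hx)
  have hlt : X (a', b') ⊂ X (a, b) := by
    refine Finset.ssubset_iff_subset_ne.2 ⟨hss, fun e => ?_⟩
    have : a ∈ X (a', b') := e ▸ (hX _ he).mem
    exact Finset.disjoint_left.1 hD this (hX _ hab').mem
  exact ih _ (hk ▸ Finset.card_lt_card hlt) _ hab'' rfl (hmono _ he _ hab'' hP hss)

/-- If every vertex of degree two has a neighbour of degree two, then every subgraph of minimum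
degree two contains two edges of `twoEdges E`. -/
theorem MinSurplus.eq_empty_of_card_le_one (h : MinSurplus A B E)
    (hA : ∀ a ∈ A, degL E a = 2 → ∃ b, (a, b) ∈ E ∧ degR E b = 2)
    (hB : ∀ b ∈ B, degR E b = 2 → ∃ a, (a, b) ∈ E ∧ degL E a = 2)
    {S : Finset (α × β)} (hSE : S ⊆ E)
    (htwo : ∀ e ∈ S, ∀ f ∈ S, e ∈ twoEdges E → f ∈ twoEdges E → e = f)
    (hS : ∀ a b, (a, b) ∈ S →
      (∃ b', b' ≠ b ∧ (a, b') ∈ S) ∧ ∃ a', a' ≠ a ∧ (a', b) ∈ S) : S = ∅ := by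
  have hdL : ∀ a b, (a, b) ∈ S → 2 ≤ degL E a :=
    fun a b hab => h.two_le_degL (h.sub a b (hSE hab)).1
  have hdR : ∀ a b, (a, b) ∈ S → 2 ≤ degR E b :=
    fun a b hab => h.two_le_degR (h.sub a b (hSE hab)).2
  have hfullL : ∀ a b b', (a, b) ∈ S → degL E a = 2 → (a, b') ∈ E → (a, b') ∈ S := by
    intro a b b' hab hd hab'
    obtain ⟨b'', hne, hab''⟩ := (hS a b hab).1
    have : ({(a, b), (a, b'')} : Finset (α × β)) = E.filter (fun e => e.1 = a) := by
      refine Finset.eq_of_subset_of_card_le ?_ ?_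
      · intro e he
        simp only [Finset.mem_insert, Finset.mem_singleton] at he
        rcases he with rfl | rfl
        · simpa using hSE hab
        · simpa using hSE hab''
      · rw [Finset.card_pair (by simpa using hne.symm)]
        exact hd.le
    have hm : (a, b') ∈ E.filter (fun e => e.1 = a) := by simpa using hab'
    rw [← this, Finset.mem_insert, Finset.mem_singleton] at hm
    rcases hm with hm | hm <;> rwa [hm]
  have hfullR : ∀ a b a', (a, b) ∈ S → degR E b = 2 → (a', b) ∈ E → (a', b) ∈ S := by
    intro a b a' hab hd hab'
    obtain ⟨a'', hne, hab''⟩ := (hS a b hab).2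
    have : ({(a, b), (a'', b)} : Finset (α × β)) = E.filter (fun e => e.2 = b) := by
      refine Finset.eq_of_subset_of_card_le ?_ ?_
      · intro e he
        simp only [Finset.mem_insert, Finset.mem_singleton] at he
        rcases he with rfl | rfl
        · simpa using hSE hab
        · simpa using hSE hab''
      · rw [Finset.card_pair (by simpa using hne.symm)]
        exact hd.le
    have hm : (a', b) ∈ E.filter (fun e => e.2 = b) := by simpa using hab'
    rw [← this, Finset.mem_insert, Finset.mem_singleton] at hm
    rcases hm with hm | hm <;> rwa [hm]
  have hmem : ∀ {a b}, (a, b) ∈ E → degL E a = 2 → degR E b = 2 → (a, b) ∈ twoEdges E :=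
    fun hab hda hdb => by simp [twoEdges, hab, hda, hdb]
  choose! X hX using h.tight
  have hXt : ∀ e ∈ S, Tight A E e.1 e.2 (X e.1 e.2) := fun e he => hX _ _ (hSE he)
  by_cases hex : ∃ a b, (a, b) ∈ S ∧ degL E a = 2 ∧ degR E b = 2
  · exfalso
    obtain ⟨a₂, b₂, hS2, hda, hdb⟩ := hex
    have hua : ∀ a b, (a, b) ∈ S → degL E a = 2 → a = a₂ := by
      intro a b hab hd
      obtain ⟨b', hab', hd'⟩ := hA a (h.sub a b (hSE hab)).1 hd
      have := htwo _ (hfullL a b b' hab hd hab') _ hS2 (hmem hab' hd hd')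
        (hmem (hSE hS2) hda hdb)
      exact congrArg Prod.fst this
    have hub : ∀ a b, (a, b) ∈ S → degR E b = 2 → b = b₂ := by
      intro a b hab hd
      obtain ⟨a', hab', hd'⟩ := hB b (h.sub a b (hSE hab)).2 hd
      have := htwo _ (hfullR a b a' hab hd hab') _ hS2 (hmem hab' hd' hd)
        (hmem (hSE hS2) hda hdb)
      exact congrArg Prod.snd this
    obtain ⟨a₁, hne, hS1⟩ := (hS a₂ b₂ hS2).2
    refine h.eq_empty_of_descent S (fun e => X e.1 e.2) hXt hSE (fun e => a₂ ∉ X e.1 e.2)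
      (fun e _ f _ he hfe hf => he (hfe hf)) ?_ (a₁, b₂) hS1
      (fun h2 => hne ((hXt _ hS1).unique a₂ h2 (hSE hS2)).symm)
    intro a b hab hP
    have haa : a ≠ a₂ := fun e => hP (e ▸ (hXt _ hab).mem)
    obtain ⟨b', hbb', hab'⟩ := (hS a b hab).1
    refine ⟨?_, b', hbb', hab', fun hU => ⟨?_, (hS a b' hab').2⟩⟩
    · have := hdL a b hab
      have : degL E a ≠ 2 := fun e => haa (hua a b hab e)
      omega
    · have := hdR a b' hab'
      have : degR E b' ≠ 2 := by
        intro e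
        obtain rfl := hub a b' hab' e
        have hm : a₂ ∈ A := (h.sub _ _ (hSE hS2)).1
        rw [← hU] at hm
        rcases Finset.mem_union.1 hm with hm | hm
        · exact hP hm
        · exact haa ((hXt _ hab').unique a₂ hm (hSE hS2)).symm
      omega
  · push Not at hex
    have hdL' : ∀ a b, (a, b) ∈ S → 3 ≤ degL E a := by
      intro a b hab
      have := hdL a b hab
      by_contra hlt
      have hd : degL E a = 2 := by omega
      obtain ⟨b', hab', hd'⟩ := hA a (h.sub a b (hSE hab)).1 hd
      exact hex a b' (hfullL a b b' hab hd hab') hd hd'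
    have hdR' : ∀ a b, (a, b) ∈ S → 3 ≤ degR E b := by
      intro a b hab
      have := hdR a b hab
      by_contra hlt
      have hd : degR E b = 2 := by omega
      obtain ⟨a', hab', hd'⟩ := hB b (h.sub a b (hSE hab)).2 hd
      exact hex a' b (hfullR a b a' hab hd hab') hd' hd
    refine Finset.eq_empty_of_forall_notMem fun e he => ?_
    refine h.eq_empty_of_descent S (fun e => X e.1 e.2) hXt hSE (fun _ => True)
      (fun _ _ _ _ _ _ => trivial) ?_ e he trivial
    intro a b hab _
    obtain ⟨b', hbb', hab'⟩ := (hS a b hab).1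
    exact ⟨hdL' a b hab, b', hbb', hab', fun _ => ⟨hdR' a b' hab', (hS a b' hab').2⟩⟩

omit [DecidableEq β] in
theorem exists_ne_of_two_le_degL {a : α} {b : β} (hd : 2 ≤ degL E a) :
    ∃ b', b' ≠ b ∧ (a, b') ∈ E := by
  obtain ⟨⟨x, y⟩, hx, hne⟩ := Finset.exists_mem_ne (show 1 < (E.filter (fun e => e.1 = a)).card
    from hd) (a, b)
  simp at hx
  obtain ⟨hxy, rfl⟩ := hx
  exact ⟨y, fun e => hne (by rw [e]), hxy⟩

theorem MinSurplus.card_add_two_le_of_no_isolated (h : MinSurplus A B E)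
    (hA : ∀ a ∈ A, degL E a = 2 → ∃ b, (a, b) ∈ E ∧ degR E b = 2)
    (hB : ∀ b ∈ B, degR E b = 2 → ∃ a, (a, b) ∈ E ∧ degL E a = 2) :
    E.card + 2 ≤ (twoEdges E).card + A.card + B.card := by
  have h2 := h.two_le
  have hsub : twoEdges E ⊆ E := Finset.filter_subset _ _
  obtain ⟨e₀, he₀⟩ : (twoEdges E).Nonempty := by
    by_contra hcon
    rw [Finset.not_nonempty_iff_eq_empty] at hcon
    have hE := h.eq_empty_of_card_le_one hA hB subset_rfl (by simp [hcon]) (fun a b hab =>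
      ⟨exists_ne_of_two_le_degL (h.two_le_degL (h.sub a b hab).1),
        h.exists_ne_adj (h.sub a b hab).2 a⟩)
    obtain ⟨b, hb⟩ : B.Nonempty := Finset.card_pos.1 (by have := h.card_eq; omega)
    obtain ⟨a, ha⟩ := h.exists_adj hb
    simp [hE] at ha
  have hins : insert e₀ (E \ twoEdges E) ⊆ E :=
    Finset.insert_subset (hsub he₀) Finset.sdiff_subset
  have := card_lt_of_exists_leaf (insert e₀ (E \ twoEdges E)) A B
    (fun a b hab => h.sub a b (hins hab)) (by omega) (by
      intro T hT hT'
      refine h.eq_empty_of_card_le_one hA hB (hT.trans hins) ?_ hT'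
      have : ∀ e ∈ T, e ∈ twoEdges E → e = e₀ := by
        intro e he he2
        have := hT he
        simp only [Finset.mem_insert, Finset.mem_sdiff] at this
        tauto
      intro e he f hf he2 hf2
      rw [this e he he2, this f hf hf2])
  rw [Finset.card_insert_of_notMem (by simp [he₀]), Finset.card_sdiff_of_subset hsub] at this
  have := Finset.card_le_card hsub
  omega

/-- The edge set with the two colour classes exchanged. -/
def swapEdges (E : Finset (α × β)) : Finset (β × α) := E.image Prod.swap

@[simp] theorem mem_swapEdges {a : α} {b : β} : (b, a) ∈ swapEdges E ↔ (a, b) ∈ E := by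
  simp [swapEdges]

theorem degL_swapEdges (b : β) : degL (swapEdges E) b = degR E b := by
  unfold degL degR swapEdges
  rw [Finset.filter_image, Finset.card_image_of_injective _ Prod.swap_injective]
  simp

theorem degR_swapEdges (a : α) : degR (swapEdges E) a = degL E a := by
  unfold degL degR swapEdges
  rw [Finset.filter_image, Finset.card_image_of_injective _ Prod.swap_injective]
  simp

theorem card_swapEdges : (swapEdges E).card = E.card :=
  Finset.card_image_of_injective _ Prod.swap_injective

theorem twoEdges_swapEdges : twoEdges (swapEdges E) = swapEdges (twoEdges E) := by
  ext ⟨b, a⟩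
  simp [twoEdges, degL_swapEdges, degR_swapEdges, and_comm]

theorem MinSurplus.swap (h : MinSurplus A B E) : MinSurplus B A (swapEdges E) := by
  have h2 := h.two_le
  have hAB := h.card_eq
  refine ⟨⟨fun b a hba => (h.sub a b (mem_swapEdges.1 hba)).symm, hAB.symm, by omega, ?_⟩, ?_⟩
  · intro Y hY hYn hYne
    have hNY : nb (swapEdges E) Y ⊆ A := by
      intro a ha
      obtain ⟨b, -, hb⟩ := mem_nb.1 ha
      exact (h.sub a b (mem_swapEdges.1 hb)).1
    have hN : nb E (A \ nb (swapEdges E) Y) ⊆ B \ Y := by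
      intro b hb
      obtain ⟨a, ha, hab⟩ := mem_nb.1 hb
      refine Finset.mem_sdiff.2 ⟨(h.sub a b hab).2, fun hbY => ?_⟩
      exact (Finset.mem_sdiff.1 ha).2 (mem_nb.2 ⟨b, hbY, mem_swapEdges.2 hab⟩)
    have c1 := Finset.card_sdiff_of_subset hY
    have c2 := Finset.card_sdiff_of_subset hNY
    have c3 := Finset.card_le_card hN
    have c4 := Finset.card_le_card hNY
    have c5 := Finset.card_lt_card (Finset.ssubset_iff_subset_ne.2 ⟨hY, hYne⟩)
    rcases (A \ nb (swapEdges E) Y).eq_empty_or_nonempty with h0 | h0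
    · rw [h0] at c2
      simp at c2
      omega
    · have := h.hall _ Finset.sdiff_subset h0 (by
        intro e
        obtain ⟨b, hb⟩ := hYn
        obtain ⟨a, ha⟩ := h.exists_adj (hY hb)
        have haA := (h.sub a b ha).1
        rw [← e] at haA
        exact (Finset.mem_sdiff.1 haA).2 (mem_nb.2 ⟨b, hb, mem_swapEdges.2 ha⟩))
      omega
  · intro b a hba
    have hab := mem_swapEdges.1 hba
    obtain ⟨haA, hbB⟩ := h.sub a b hab
    obtain ⟨X, hX⟩ := h.tight a b hab
    have hbX : b ∈ nb E X := mem_nb.2 ⟨a, hX.mem, hab⟩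
    have hXc := h.hall X hX.sub ⟨a, hX.mem⟩ hX.ne
    have hXpos := Finset.card_pos.2 ⟨a, hX.mem⟩
    have c1 := Finset.card_sdiff_of_subset (h.nb_subset X)
    have c2 := Finset.card_sdiff_of_subset hX.sub
    have c3 := Finset.card_le_card (h.nb_subset X)
    have c4 := Finset.card_le_card hX.sub
    have c6 := hX.card_le
    have c5 : (insert b (B \ nb E X)).card = (B \ nb E X).card + 1 :=
      Finset.card_insert_of_notMem (by simp [hbX])
    refine ⟨insert b (B \ nb E X), Finset.insert_subset hbB Finset.sdiff_subset,
      Finset.mem_insert_self _ _, fun e => ?_, ?_, ?_⟩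
    · rw [e] at c5
      omega
    · have hN : nb (swapEdges E) (insert b (B \ nb E X)) ⊆ insert a (A \ X) := by
        intro x hx
        obtain ⟨y, hy, hyx⟩ := mem_nb.1 hx
        have hxy := mem_swapEdges.1 hyx
        by_cases hxX : x ∈ X
        · rcases Finset.mem_insert.1 hy with rfl | hy
          · rw [hX.unique x hxX hxy]
            exact Finset.mem_insert_self _ _
          · exact absurd (mem_nb.2 ⟨x, hxX, hxy⟩) (Finset.mem_sdiff.1 hy).2
        · exact Finset.mem_insert_of_mem (Finset.mem_sdiff.2 ⟨(h.sub x y hxy).1, hxX⟩)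
      have := Finset.card_le_card hN
      have := Finset.card_insert_le a (A \ X)
      omega
    · intro y hy hya
      rcases Finset.mem_insert.1 hy with rfl | hy
      · rfl
      · exact absurd (mem_nb.2 ⟨a, hX.mem, mem_swapEdges.1 hya⟩) (Finset.mem_sdiff.1 hy).2

/-- The edge set obtained by deleting `b` and identifying `a'` with `a`. -/
def contract (E : Finset (α × β)) (a a' : α) (b : β) : Finset (α × β) :=
  (E.filter (fun e => e.2 ≠ b)).image (fun e => (if e.1 = a' then a else e.1, e.2))

theorem mem_contract {a a' x : α} {b y : β} :
    (x, y) ∈ contract E a a' b ↔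
      ∃ x', (x', y) ∈ E ∧ y ≠ b ∧ (if x' = a' then a else x') = x := by
  simp only [contract, Finset.mem_image, Finset.mem_filter, Prod.exists, Prod.mk.injEq]
  constructor
  · rintro ⟨x', y', ⟨h1, h2⟩, h3, rfl⟩
    exact ⟨x', h1, h2, h3⟩
  · rintro ⟨x', h1, h2, h3⟩
    exact ⟨x', y, ⟨h1, h2⟩, h3, rfl⟩

omit [DecidableEq α] in
theorem eq_or_eq_of_degR_eq_two {a a' : α} {b : β} (hab : (a, b) ∈ E) (hab' : (a', b) ∈ E)
    (hne : a ≠ a') (hd : degR E b = 2) {x : α} (hx : (x, b) ∈ E) : x = a ∨ x = a' := by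
  classical
  have : ({(a, b), (a', b)} : Finset (α × β)) = E.filter (fun e => e.2 = b) := by
    refine Finset.eq_of_subset_of_card_le ?_ ?_
    · intro e he
      simp only [Finset.mem_insert, Finset.mem_singleton] at he
      rcases he with rfl | rfl
      · simpa using hab
      · simpa using hab'
    · rw [Finset.card_pair (by simpa using hne)]
      exact hd.le
  have hm : (x, b) ∈ E.filter (fun e => e.2 = b) := by simpa using hx
  rw [← this, Finset.mem_insert, Finset.mem_singleton] at hm
  simpa using hm

/-- A minimum set at an edge from a neighbour `a` of a vertex `b` of degree two contains the
other neighbour of `b`. -/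
theorem MinSurplus.mem_of_tight (h : MinSurplus A B E) {a a' : α} {b y : β} {X : Finset α}
    (hab : (a, b) ∈ E) (hab' : (a', b) ∈ E) (hne : a ≠ a') (hd : degR E b = 2)
    (hda : 3 ≤ degL E a) (hay : (a, y) ∈ E) (hyb : y ≠ b) (hX : Tight A E a y X) : a' ∈ X := by
  by_contra hcon
  have hX' : Tight A E a b X := ⟨hX.sub, hX.mem, hX.ne, hX.card_le, fun x hx hxb => by
    rcases eq_or_eq_of_degR_eq_two hab hab' hne hd hxb with rfl | rfl
    · rfl
    · exact absurd hx hcon⟩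
  have := h.union_eq hay hab hyb hda hX hX'
  rw [Finset.union_self] at this
  exact hX.ne this

/-- Each edge avoiding `b` has a minimum set that does not separate the neighbours of `b`. -/
theorem MinSurplus.exists_tight_iff (h : MinSurplus A B E) {a a' : α} {b : β}
    (hab : (a, b) ∈ E) (hab' : (a', b) ∈ E) (hne : a ≠ a') (hd : degR E b = 2)
    (hda : 3 ≤ degL E a) (hda' : 3 ≤ degL E a') {x : α} {y : β} (hxy : (x, y) ∈ E)
    (hyb : y ≠ b) : ∃ X, Tight A E x y X ∧ (a ∈ X ↔ a' ∈ X) := by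
  have key : ∀ {a a' : α} {X : Finset α}, (a, b) ∈ E → (a', b) ∈ E → a ≠ a' → 3 ≤ degL E a →
      Tight A E x y X → a ∈ X → a' ∉ X → Tight A E x y (X.erase a) := by
    intro a a' X hab hab' hne hda hX ha ha'
    have hxa : x ≠ a := by
      rintro rfl
      exact ha' (h.mem_of_tight hab hab' hne hd hda hxy hyb hX)
    refine ⟨(Finset.erase_subset _ _).trans hX.sub, Finset.mem_erase.2 ⟨hxa, hX.mem⟩,
      fun e => ?_, ?_, fun z hz => hX.unique z (Finset.mem_of_mem_erase hz)⟩
    · have := hX.sub ha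
      rw [← e] at this
      simp at this
    · have hsub : nb E (X.erase a) ⊆ (nb E X).erase b := by
        intro z hz
        obtain ⟨w, hw, hwz⟩ := mem_nb.1 hz
        obtain ⟨hwa, hw⟩ := Finset.mem_erase.1 hw
        refine Finset.mem_erase.2 ⟨?_, mem_nb.2 ⟨w, hw, hwz⟩⟩
        rintro rfl
        rcases eq_or_eq_of_degR_eq_two hab hab' hne hd hwz with rfl | rfl
        · exact hwa rfl
        · exact ha' hw
      have c := Finset.card_le_card hsub
      rw [Finset.card_erase_of_mem (mem_nb.2 ⟨a, ha, hab⟩)] at c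
      rw [Finset.card_erase_of_mem ha]
      have := hX.card_le
      omega
  obtain ⟨X, hX⟩ := h.tight x y hxy
  by_cases ha : a ∈ X <;> by_cases ha' : a' ∈ X
  · exact ⟨X, hX, by tauto⟩
  · exact ⟨_, key hab hab' hne hda hX ha ha', by simp [ha']⟩
  · exact ⟨_, key hab' hab hne.symm hda' hX ha' ha, by simp [ha]⟩
  · exact ⟨X, hX, by tauto⟩

theorem nb_contract {a a' : α} {b : β} (X : Finset α) (hsub : ∀ x y, (x, y) ∈ E → x ∈ A) :
    nb (contract E a a' b) X =
      (nb E (A.filter (fun x => (if x = a' then a else x) ∈ X))).erase b := by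
  ext y
  simp only [mem_nb, mem_contract, Finset.mem_erase, Finset.mem_filter]
  constructor
  · rintro ⟨x, hx, x', hxy, hyb, rfl⟩
    exact ⟨hyb, x', ⟨hsub _ _ hxy, hx⟩, hxy⟩
  · rintro ⟨hyb, x', ⟨-, hx⟩, hxy⟩
    exact ⟨_, hx, x', hxy, hyb, rfl⟩

theorem MinSurplus.not_adj_of_adj (h : MinSurplus A B E) {a a' : α} {b y : β}
    (hab : (a, b) ∈ E) (hab' : (a', b) ∈ E) (hne : a ≠ a') (hd : degR E b = 2)
    (hda : 3 ≤ degL E a) (hay : (a, y) ∈ E) (hyb : y ≠ b) : (a', y) ∉ E := by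
  intro ha'y
  obtain ⟨X, hX⟩ := h.tight a y hay
  exact hne (hX.unique a' (h.mem_of_tight hab hab' hne hd hda hay hyb hX) ha'y).symm

theorem MinSurplus.contract_injOn (h : MinSurplus A B E) {a a' : α} {b : β}
    (hab : (a, b) ∈ E) (hab' : (a', b) ∈ E) (hne : a ≠ a') (hd : degR E b = 2)
    (hda : 3 ≤ degL E a) :
    Set.InjOn (fun e : α × β => (if e.1 = a' then a else e.1, e.2))
      (E.filter (fun e => e.2 ≠ b)) := by
  rintro ⟨x, y⟩ hx ⟨x', y'⟩ hx' heq
  simp only [Finset.coe_filter, Set.mem_ofPred_eq] at hx hx'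
  simp only [Prod.mk.injEq] at heq
  obtain ⟨heq, rfl⟩ := heq
  split_ifs at heq with h1 h2 h2
  · rw [h1, h2]
  · subst h1 heq
    exact absurd hx.1 (h.not_adj_of_adj hab hab' hne hd hda hx'.1 hx.2)
  · subst h2 heq
    exact absurd hx'.1 (h.not_adj_of_adj hab hab' hne hd hda hx.1 hx.2)
  · rw [heq]

theorem MinSurplus.card_contract (h : MinSurplus A B E) {a a' : α} {b : β}
    (hab : (a, b) ∈ E) (hab' : (a', b) ∈ E) (hne : a ≠ a') (hd : degR E b = 2)
    (hda : 3 ≤ degL E a) : (contract E a a' b).card + 2 = E.card := by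
  rw [contract, Finset.card_image_of_injOn (h.contract_injOn hab hab' hne hd hda)]
  have := Finset.card_filter_add_card_filter_not (s := E) (fun e => e.2 = b)
  unfold degR at hd
  simp only [ne_eq]
  omega

theorem MinSurplus.contract (h : MinSurplus A B E) {a a' : α} {b : β}
    (hab : (a, b) ∈ E) (hab' : (a', b) ∈ E) (hne : a ≠ a') (hd : degR E b = 2)
    (hda : 3 ≤ degL E a) (hda' : 3 ≤ degL E a') :
    MinSurplus (A.erase a') (B.erase b) (contract E a a' b) := by
  obtain ⟨haA, hbB⟩ := h.sub a b hab
  have ha'A := (h.sub a' b hab').1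
  have cA := Finset.card_erase_of_mem ha'A
  have cB := Finset.card_erase_of_mem hbB
  have hAB := h.card_eq
  have hsubA : ∀ x y, (x, y) ∈ E → x ∈ A := fun x y hxy => (h.sub x y hxy).1
  have hB3 : 3 ≤ B.card := by
    have := Finset.card_le_card (h.nb_subset {a})
    rw [card_nb_singleton] at this
    omega
  refine ⟨⟨?_, by omega, by omega, ?_⟩, ?_⟩
  · intro x y hxy
    obtain ⟨x', hxy', hyb, rfl⟩ := mem_contract.1 hxy
    refine ⟨?_, Finset.mem_erase.2 ⟨hyb, (h.sub _ _ hxy').2⟩⟩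
    split_ifs with h1
    · exact Finset.mem_erase.2 ⟨hne, haA⟩
    · exact Finset.mem_erase.2 ⟨h1, (h.sub _ _ hxy').1⟩
  · intro X hXA hXn hXne
    rw [nb_contract X hsubA]
    have ha'X : a' ∉ X := fun h' => by simpa using hXA h'
    by_cases ha : a ∈ X
    · have hlift : A.filter (fun x => (if x = a' then a else x) ∈ X) = insert a' X := by
        ext x
        simp only [Finset.mem_filter, Finset.mem_insert]
        constructor
        · rintro ⟨hx, hx'⟩
          split_ifs at hx' with h1
          · exact Or.inl h1
          · exact Or.inr hx'
        · rintro (rfl | hx)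
          · simpa [ha'A] using ha
          · refine ⟨Finset.mem_of_mem_erase (hXA hx), ?_⟩
            rw [if_neg]
            · exact hx
            · rintro rfl; exact ha'X hx
      rw [hlift, Finset.card_erase_of_mem (mem_nb.2 ⟨a', by simp, hab'⟩)]
      have := h.hall (insert a' X)
        (Finset.insert_subset ha'A (hXA.trans (Finset.erase_subset _ _))) (by simp)
        (fun e => hXne (by rw [← e, Finset.erase_insert ha'X]))
      rw [Finset.card_insert_of_notMem ha'X] at this
      omega
    · have hlift : A.filter (fun x => (if x = a' then a else x) ∈ X) = X := by
        ext x
        simp only [Finset.mem_filter]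
        constructor
        · rintro ⟨hx, hx'⟩
          split_ifs at hx' with h1
          · exact absurd hx' ha
          · exact hx'
        · intro hx
          refine ⟨Finset.mem_of_mem_erase (hXA hx), ?_⟩
          rw [if_neg]
          · exact hx
          · rintro rfl; exact ha'X hx
      rw [hlift, Finset.erase_eq_of_notMem]
      · exact h.hall X (hXA.trans (Finset.erase_subset _ _)) hXn
          (fun e => ha (e ▸ haA))
      · intro hb
        obtain ⟨x, hx, hxb⟩ := mem_nb.1 hb
        rcases eq_or_eq_of_degR_eq_two hab hab' hne hd hxb with rfl | rfl
        · exact ha hx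
        · exact ha'X hx
  · intro x y hxy
    obtain ⟨x', hxy', hyb, rfl⟩ := mem_contract.1 hxy
    obtain ⟨X, hX, hiff⟩ := h.exists_tight_iff hab hab' hne hd hda hda' hxy' hyb
    have hlift : A.filter (fun x => (if x = a' then a else x) ∈ X.erase a') = X := by
      ext z
      simp only [Finset.mem_filter, Finset.mem_erase]
      constructor
      · rintro ⟨hz, -, hz'⟩
        split_ifs at hz' with h1
        · rw [h1]; exact hiff.1 hz'
        · exact hz'
      · intro hz
        refine ⟨hX.sub hz, ?_⟩
        split_ifs with h1
        · subst h1
          exact ⟨hne, hiff.2 hz⟩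
        · exact ⟨h1, hz⟩
    refine ⟨X.erase a', Finset.erase_subset_erase _ hX.sub, ?_, fun e => hX.ne ?_, ?_, ?_⟩
    · have := hX.mem
      rw [← hlift] at this
      exact (Finset.mem_filter.1 this).2
    · have haX : a ∈ X := by
        have : a ∈ A.erase a' := Finset.mem_erase.2 ⟨hne, haA⟩
        rw [← e] at this
        exact Finset.mem_of_mem_erase this
      rw [← Finset.insert_erase (hiff.1 haX), e, Finset.insert_erase ha'A]
    · rw [nb_contract _ hsubA, hlift]
      have c := hX.card_le
      by_cases ha : a ∈ X
      · rw [Finset.card_erase_of_mem (mem_nb.2 ⟨a, ha, hab⟩),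
          Finset.card_erase_of_mem (hiff.1 ha)]
        have := Finset.card_pos.2 ⟨a, ha⟩
        omega
      · rw [Finset.erase_eq_of_notMem (a := a') (fun h' => ha (hiff.2 h'))]
        have := Finset.card_erase_le (s := nb E X) (a := b)
        omega
    · intro z hz hzy
      obtain ⟨z', hzy', -, rfl⟩ := mem_contract.1 hzy
      have : z' ∈ X := by
        rw [← hlift]
        exact Finset.mem_filter.2 ⟨(h.sub _ _ hzy').1, hz⟩
      rw [hX.unique z' this hzy']

theorem MinSurplus.twoEdges_contract_subset (h : MinSurplus A B E) {a a' : α} {b : β}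
    (hab : (a, b) ∈ E) (hab' : (a', b) ∈ E) (hne : a ≠ a') (hd : degR E b = 2)
    (hda : 3 ≤ degL E a) (hda' : 3 ≤ degL E a') :
    twoEdges (BipartiteEdges.contract E a a' b) ⊆ twoEdges E := by
  have hsubA : ∀ x y, (x, y) ∈ E → x ∈ A := fun x y hxy => (h.sub x y hxy).1
  have haA := hsubA _ _ hab
  have ha'A := hsubA _ _ hab'
  rintro ⟨x, y⟩ hxy
  simp only [twoEdges, Finset.mem_filter] at hxy ⊢
  obtain ⟨hxy, hdx, hdy⟩ := hxy
  obtain ⟨x', hxy', hyb, rfl⟩ := mem_contract.1 hxy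
  have hdy' : degR (BipartiteEdges.contract E a a' b) y = degR E y := by
    unfold degR BipartiteEdges.contract
    rw [Finset.filter_image, Finset.card_image_of_injOn]
    · rw [Finset.filter_filter]
      congr 1
      refine Finset.filter_congr fun e _ => ?_
      constructor
      · exact fun h => h.2
      · rintro rfl; exact ⟨hyb, rfl⟩
    · exact (h.contract_injOn hab hab' hne hd hda).mono (by
        rw [Finset.coe_subset]; exact Finset.filter_subset _ _)
  rw [hdy'] at hdy
  have hbig : degL (BipartiteEdges.contract E a a' b) a ≠ 2 := by
    obtain ⟨z, hzb, hz⟩ := exists_ne_of_two_le_degL (b := b) (show 2 ≤ degL E a' by omega)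
    have hza : z ∉ nb E {a} := by
      intro hza
      have : (a, z) ∈ E := by simpa using hza
      exact h.not_adj_of_adj hab hab' hne hd hda this hzb hz
    have hsub : insert z (nb E {a}) ⊆
        nb E (A.filter (fun x => (if x = a' then a else x) ∈ ({a} : Finset α))) := by
      intro w hw
      rcases Finset.mem_insert.1 hw with rfl | hw
      · exact mem_nb.2 ⟨a', by simp [ha'A], hz⟩
      · obtain ⟨u, hu, huw⟩ := mem_nb.1 hw
        rw [Finset.mem_singleton] at hu
        subst hu
        exact mem_nb.2 ⟨u, by simp [haA], huw⟩
    have c := Finset.card_le_card hsub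
    rw [Finset.card_insert_of_notMem hza, card_nb_singleton] at c
    rw [← card_nb_singleton, nb_contract _ hsubA]
    have := Finset.pred_card_le_card_erase (a := b)
      (s := nb E (A.filter (fun x => (if x = a' then a else x) ∈ ({a} : Finset α))))
    omega
  have hx'a' : x' ≠ a' := by
    rintro rfl
    rw [if_pos rfl] at hdx
    exact hbig hdx
  rw [if_neg hx'a'] at hdx ⊢
  have hx'a : x' ≠ a := by
    rintro rfl
    exact hbig hdx
  refine ⟨hxy', ?_, hdy⟩
  rw [← hdx, ← card_nb_singleton, ← card_nb_singleton, nb_contract _ hsubA]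
  have hlift : A.filter (fun x => (if x = a' then a else x) ∈ ({x'} : Finset α)) = {x'} := by
    ext z
    simp only [Finset.mem_filter, Finset.mem_singleton]
    constructor
    · rintro ⟨-, hz⟩
      split_ifs at hz with h1
      · exact absurd hz.symm hx'a
      · exact hz
    · rintro rfl
      exact ⟨hsubA _ _ hxy', if_neg hx'a'⟩
  rw [hlift, Finset.erase_eq_of_notMem]
  intro hb
  have : (x', b) ∈ E := by simpa using hb
  rcases eq_or_eq_of_degR_eq_two hab hab' hne hd this with rfl | rfl
  · exact hx'a rfl
  · exact hx'a' rfl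

/-- If some vertex of degree two in the second class has no neighbour of degree two, then there
is a smaller example with at most as many edges in `twoEdges` and the same cyclomatic number. -/
theorem MinSurplus.exists_smaller (h : MinSurplus A B E) {b : β} (hb : b ∈ B)
    (hd : degR E b = 2) (hiso : ∀ a, (a, b) ∈ E → degL E a ≠ 2) :
    ∃ (A' : Finset α) (B' : Finset β) (E' : Finset (α × β)), MinSurplus A' B' E' ∧
      A'.card + 1 = A.card ∧ B'.card + 1 = B.card ∧ E'.card + 2 = E.card ∧
      (twoEdges E').card ≤ (twoEdges E).card := by
  obtain ⟨a, hab⟩ := h.exists_adj hb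
  obtain ⟨a', hne, hab'⟩ := h.exists_ne_adj hb a
  have haA := (h.sub a b hab).1
  have ha'A := (h.sub a' b hab').1
  have hda : 3 ≤ degL E a := by
    have := h.two_le_degL haA
    have := hiso a hab
    omega
  have hda' : 3 ≤ degL E a' := by
    have := h.two_le_degL ha'A
    have := hiso a' hab'
    omega
  exact ⟨_, _, _, h.contract hab hab' hne.symm hd hda hda', Finset.card_erase_add_one ha'A,
    Finset.card_erase_add_one hb, h.card_contract hab hab' hne.symm hd hda,
    Finset.card_le_card (h.twoEdges_contract_subset hab hab' hne.symm hd hda hda')⟩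

theorem MinSurplus.card_add_two_le (h : MinSurplus A B E) :
    E.card + 2 ≤ (twoEdges E).card + A.card + B.card := by
  suffices H : ∀ k (A : Finset α) (B : Finset β) (E : Finset (α × β)), A.card = k →
      MinSurplus A B E → E.card + 2 ≤ (twoEdges E).card + A.card + B.card from H _ A B E rfl h
  intro k
  induction k with
  | zero =>
    intro A B E hA h
    have := h.two_le
    omega
  | succ k ih =>
    intro A B E hk h
    by_cases hB : ∀ b ∈ B, degR E b = 2 → ∃ a, (a, b) ∈ E ∧ degL E a = 2
    · by_cases hA : ∀ a ∈ A, degL E a = 2 → ∃ b, (a, b) ∈ E ∧ degR E b = 2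
      · exact h.card_add_two_le_of_no_isolated hA hB
      · push Not at hA
        obtain ⟨a, ha, hd, hiso⟩ := hA
        obtain ⟨B', A', E', h', cB, cA, cE, c2⟩ := h.swap.exists_smaller ha
          (by rw [degR_swapEdges, hd])
          (fun b hb => by rw [degL_swapEdges]; exact hiso b (mem_swapEdges.1 hb))
        have := ih A' B' (swapEdges E') (by omega) h'.swap
        rw [twoEdges_swapEdges, card_swapEdges, card_swapEdges] at this
        rw [twoEdges_swapEdges, card_swapEdges] at c2
        rw [card_swapEdges] at cE
        omega
    · push Not at hB
      obtain ⟨b, hb, hd, hiso⟩ := hB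
      obtain ⟨A', B', E', h', cA, cB, cE, c2⟩ := h.exists_smaller hb hd hiso
      have := ih A' B' E' (by omega) h'
      omega

omit [DecidableEq β] in
theorem sum_degL (hsub : ∀ e ∈ E, e.1 ∈ A) : ∑ a ∈ A, degL E a = E.card :=
  (Finset.card_eq_sum_card_fiberwise hsub).symm

omit [DecidableEq β] in
theorem three_mul_card_le (hsub : ∀ e ∈ E, e.1 ∈ A) (h2 : ∀ a ∈ A, 2 ≤ degL E a) :
    3 * A.card ≤ E.card + (A.filter (fun a => degL E a = 2)).card := by
  rw [← sum_degL hsub, Finset.card_filter, ← Finset.sum_add_distrib, mul_comm, ← smul_eq_mul,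
    ← Finset.sum_const]
  refine Finset.sum_le_sum fun a ha => ?_
  have := h2 a ha
  split_ifs with h <;> omega

omit [DecidableEq β] in
theorem two_mul_card_filter (hsub : ∀ e ∈ E, e.1 ∈ A) :
    2 * (A.filter (fun a => degL E a = 2)).card = (E.filter (fun e => degL E e.1 = 2)).card := by
  rw [Finset.card_eq_sum_card_fiberwise (s := E.filter (fun e => degL E e.1 = 2))
    (t := A.filter (fun a => degL E a = 2)) (f := Prod.fst)]
  · rw [mul_comm, ← smul_eq_mul, ← Finset.sum_const]
    refine Finset.sum_congr rfl fun a ha => ?_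
    refine (Finset.mem_filter.1 ha).2.symm.trans ?_
    rw [Finset.filter_filter]
    refine congrArg Finset.card ?_
    refine Finset.filter_congr fun e _ => ?_
    constructor
    · rintro rfl; exact ⟨(Finset.mem_filter.1 ha).2, rfl⟩
    · exact fun h => h.2
  · intro e he
    have he : e ∈ E ∧ degL E e.1 = 2 := by simpa using he
    simpa using ⟨hsub e he.1, he.2⟩

theorem MinSurplus.card_add_ten_le (h : MinSurplus A B E) :
    A.card + B.card + 10 ≤ 6 * (twoEdges E).card := by
  have key := h.card_add_two_le
  have hA : ∀ e ∈ E, e.1 ∈ A := fun e he => (h.sub e.1 e.2 he).1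
  have hB : ∀ e ∈ swapEdges E, e.1 ∈ B := fun e he => (h.swap.sub e.1 e.2 he).1
  have a3 := three_mul_card_le hA fun a => h.two_le_degL
  have b3 := three_mul_card_le hB fun b => h.swap.two_le_degL
  have a2 := two_mul_card_filter hA
  have b2 := two_mul_card_filter hB
  have e2 : ((swapEdges E).filter (fun e => degL (swapEdges E) e.1 = 2)).card =
      (E.filter (fun e => degR E e.2 = 2)).card := by
    simp only [degL_swapEdges]
    rw [swapEdges, Finset.filter_image, Finset.card_image_of_injective _ Prod.swap_injective]
    simp
  have e3 := Finset.card_union_add_card_inter (E.filter (fun e => degL E e.1 = 2))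
    (E.filter (fun e => degR E e.2 = 2))
  rw [← Finset.filter_and, ← Finset.filter_or] at e3
  have e4 := Finset.card_filter_le E (fun e => degL E e.1 = 2 ∨ degR E e.2 = 2)
  rw [card_swapEdges] at b3
  unfold twoEdges at *
  omega

section Graph

variable {V : Type*} [Fintype V] [DecidableEq V]

open Classical in
/-- The edges of `G` directed from the colour class `A` to its complement. -/
noncomputable def orientedEdges (G : SimpleGraph V) (A : Finset V) : Finset (V × V) :=
  Finset.univ.filter (fun e => e.1 ∈ A ∧ G.Adj e.1 e.2)

@[simp] theorem mem_orientedEdges {G : SimpleGraph V} {A : Finset V} {e : V × V} :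
    e ∈ orientedEdges G A ↔ e.1 ∈ A ∧ G.Adj e.1 e.2 := by
  simp [orientedEdges]

omit [DecidableEq V] in
theorem exists_matching_map {G : SimpleGraph V} (h : MatchingCovered G) {x y : V}
    (hxy : G.Adj x y) :
    ∃ m : V → V, m.Injective ∧ (∀ v, G.Adj v (m v)) ∧ m x = y ∧ m y = x := by
  obtain ⟨M, hM, he⟩ := h.2.2 s(x, y) hxy
  rw [Subgraph.isPerfectMatching_iff] at hM
  choose m hm hu using hM
  refine ⟨m, fun v w hvw => ?_, fun v => (hm v).adj_sub, (hu x y he).symm,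
    (hu y x (M.adj_symm he)).symm⟩
  rw [hu (m v) v ((hm v).symm), hu (m v) w (hvw ▸ (hm w).symm)]

theorem surplus_of_matchingCovered {G : SimpleGraph V} {A : Finset V}
    (hA : ∀ u v, G.Adj u v → (u ∈ A ↔ v ∉ A)) (h : MatchingCovered G) :
    Surplus A Aᶜ (orientedEdges G A) := by
  have hcard := h.2.1
  have hadj : ∀ v, ∃ w, G.Adj v w := by
    intro v
    have : Nontrivial V := Fintype.one_lt_card_iff_nontrivial.1 (by omega)
    exact h.1.preconnected.exists_adj_of_nontrivial v
  have hV : Nonempty V := h.1.nonempty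
  obtain ⟨v₀⟩ := hV
  obtain ⟨w₀, hvw₀⟩ := hadj v₀
  obtain ⟨m, hmi, hma, -, -⟩ := exists_matching_map h hvw₀
  have hle1 : A.card ≤ Aᶜ.card := Finset.card_le_card_of_injOn m (fun v hv => by
    simpa using (hA v _ (hma v)).1 hv) hmi.injOn
  have hle2 : Aᶜ.card ≤ A.card := Finset.card_le_card_of_injOn m (fun v hv => by
    have := hA v _ (hma v)
    simp at hv
    simpa using not_not.1 (fun hn => hv (this.2 hn))) hmi.injOn
  have hsum := Finset.card_add_card_compl A
  refine ⟨fun a b hab => ?_, le_antisymm hle1 hle2, by omega, ?_⟩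
  · simp only [mem_orientedEdges] at hab
    exact ⟨hab.1, by simpa using (hA _ _ hab.2).1 hab.1⟩
  · intro X hXA hXn hXne
    have hNimg : ∀ m : V → V, (∀ v, G.Adj v (m v)) →
        X.image m ⊆ nb (orientedEdges G A) X := by
      intro m hma w hw
      obtain ⟨v, hv, rfl⟩ := Finset.mem_image.1 hw
      exact mem_nb.2 ⟨v, hv, by simpa using ⟨hXA hv, hma v⟩⟩
    obtain ⟨x, y, hxA, hxX, hy, hxy⟩ : ∃ x y, x ∈ A ∧ x ∉ X ∧
        y ∈ nb (orientedEdges G A) X ∧ G.Adj x y := by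
      by_contra! hcon
      obtain ⟨u, hu⟩ := hXn
      have hclosed : ∀ v w, G.Adj v w → (v ∈ X ∨ v ∈ nb (orientedEdges G A) X) →
          (w ∈ X ∨ w ∈ nb (orientedEdges G A) X) := by
        rintro v w hvw (hv | hv)
        · exact Or.inr (mem_nb.2 ⟨v, hv, by simpa using ⟨hXA hv, hvw⟩⟩)
        · left
          by_contra hw
          refine hcon w v ?_ hw hv hvw.symm
          obtain ⟨z, hz, hzv⟩ := mem_nb.1 hv
          have := hA _ _ (mem_orientedEdges.1 hzv).2
          have h' := hA _ _ hvw
          have := this.1 (hXA hz)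
          exact not_not.1 (fun hn => this (h'.2 hn))
      have hall : ∀ w, w ∈ X ∨ w ∈ nb (orientedEdges G A) X := by
        intro w
        have hr := (SimpleGraph.reachable_iff_reflTransGen u w).1 (h.1.preconnected u w)
        induction hr with
        | refl => exact Or.inl hu
        | tail _ hvw ih => exact hclosed _ _ hvw ih
      refine hXne (Finset.Subset.antisymm hXA fun a ha => ?_)
      rcases hall a with h' | h'
      · exact h'
      · obtain ⟨z, hz, hza⟩ := mem_nb.1 h'
        exact absurd ha ((hA _ _ (mem_orientedEdges.1 hza).2).1 (hXA hz))
    obtain ⟨m, hmi, hma, hmx, -⟩ := exists_matching_map h hxy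
    have hss : X.image m ⊂ nb (orientedEdges G A) X := by
      refine Finset.ssubset_iff_subset_ne.2 ⟨hNimg m hma, fun e => ?_⟩
      rw [← e] at hy
      obtain ⟨v, hv, hvy⟩ := Finset.mem_image.1 hy
      exact hxX (hmi (hvy.trans hmx.symm) ▸ hv)
    have := Finset.card_lt_card hss
    rwa [Finset.card_image_of_injective _ hmi] at this

theorem connected_of_surplus {G : SimpleGraph V} {A : Finset V}
    (h : Surplus A Aᶜ (orientedEdges G A)) :
    G.Connected := by
  classical
  have h2 := h.two_le
  have hAc := h.card_eq
  obtain ⟨a₀, ha₀⟩ : A.Nonempty := Finset.card_pos.1 (by omega)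
  have : Nonempty V := ⟨a₀⟩
  refine ⟨fun u w => ?_⟩
  let R : Finset V := Finset.univ.filter (fun w => G.Reachable u w)
  have hR : ∀ v w, G.Adj v w → (v ∈ R ↔ w ∈ R) := by
    intro v w hvw
    simp only [R, Finset.mem_filter, Finset.mem_univ, true_and]
    exact ⟨fun h => h.trans hvw.reachable, fun h => h.trans hvw.symm.reachable⟩
  have hRA : A ∩ R = A := by
    by_contra hne
    have hn : (A ∩ R).Nonempty := by
      have huR : u ∈ R := by simp [R]
      by_cases hu : u ∈ A
      · exact ⟨u, Finset.mem_inter.2 ⟨hu, huR⟩⟩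
      · obtain ⟨x, hx⟩ := h.exists_adj (b := u) (by simpa using hu)
        have hx' := mem_orientedEdges.1 hx
        exact ⟨x, Finset.mem_inter.2 ⟨hx'.1, (hR _ _ hx'.2).2 huR⟩⟩
    have hn' : (A \ R).Nonempty := by
      rw [Finset.nonempty_iff_ne_empty]
      intro h0
      exact hne (Finset.inter_eq_left.2 (Finset.sdiff_eq_empty_iff_subset.1 h0))
    have h1 := h.hall _ Finset.inter_subset_left hn hne
    have h3 := h.hall (A \ R) Finset.sdiff_subset hn' (fun e => by
      obtain ⟨x, hx⟩ := hn
      obtain ⟨hxA, hxR⟩ := Finset.mem_inter.1 hx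
      rw [← e] at hxA
      exact (Finset.mem_sdiff.1 hxA).2 hxR)
    have s1 : nb (orientedEdges G A) (A ∩ R) ⊆ Aᶜ ∩ R := by
      intro y hy
      obtain ⟨x, hx, hxy⟩ := mem_nb.1 hy
      exact Finset.mem_inter.2 ⟨(h.sub _ _ hxy).2,
        (hR _ _ (mem_orientedEdges.1 hxy).2).1 (Finset.mem_inter.1 hx).2⟩
    have s2 : nb (orientedEdges G A) (A \ R) ⊆ Aᶜ \ R := by
      intro y hy
      obtain ⟨x, hx, hxy⟩ := mem_nb.1 hy
      exact Finset.mem_sdiff.2 ⟨(h.sub _ _ hxy).2, fun hyR =>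
        (Finset.mem_sdiff.1 hx).2 ((hR _ _ (mem_orientedEdges.1 hxy).2).2 hyR)⟩
    have c1 := Finset.card_le_card s1
    have c2 := Finset.card_le_card s2
    have e1 := Finset.card_inter_add_card_sdiff A R
    have e2 := Finset.card_inter_add_card_sdiff Aᶜ R
    omega
  have hwR : w ∈ R := by
    by_cases hw : w ∈ A
    · rw [← hRA] at hw
      exact (Finset.mem_inter.1 hw).2
    · obtain ⟨x, hx⟩ := h.exists_adj (b := w) (by simpa using hw)
      have hx' := mem_orientedEdges.1 hx
      have hxR := hx'.1
      rw [← hRA] at hxR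
      exact (hR _ _ hx'.2).1 (Finset.mem_inter.1 hxR).2
  simpa [R] using hwR

theorem exists_perfectMatching_of_surplus {G : SimpleGraph V} {A : Finset V}
    (h : Surplus A Aᶜ (orientedEdges G A)) {x y : V} (hx : x ∈ A) (hxy : G.Adj x y) :
    ∃ M : G.Subgraph, M.IsPerfectMatching ∧ M.Adj x y := by
  have hyA : y ∈ Aᶜ := (h.sub x y (by simpa using ⟨hx, hxy⟩)).2
  have hhall := (Finset.all_card_le_biUnion_card_iff_exists_injective
    (fun a : {a // a ∈ A ∧ a ≠ x} => (nb (orientedEdges G A) {a.1}).erase y)).1 (by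
      intro s
      rcases s.eq_empty_or_nonempty with rfl | hs
      · simp
      have hsub : s.map (Function.Embedding.subtype _) ⊆ A := by
        intro a ha
        simp only [Finset.mem_map, Function.Embedding.subtype_apply] at ha
        obtain ⟨a, -, rfl⟩ := ha
        exact a.2.1
      have := h.hall _ hsub (hs.map) (fun e => by
        rw [← e] at hx
        simp only [Finset.mem_map, Function.Embedding.subtype_apply] at hx
        obtain ⟨a, -, ha⟩ := hx
        exact a.2.2 ha)
      rw [Finset.card_map] at this
      have h2 := Finset.pred_card_le_card_erase (a := y)
        (s := nb (orientedEdges G A) (s.map (Function.Embedding.subtype _)))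
      refine (Nat.le_sub_one_of_lt this).trans (h2.trans (Finset.card_le_card ?_))
      intro z hz
      obtain ⟨hzy, hz⟩ := Finset.mem_erase.1 hz
      obtain ⟨w, hw, hwz⟩ := mem_nb.1 hz
      simp only [Finset.mem_map, Function.Embedding.subtype_apply] at hw
      obtain ⟨a, ha, rfl⟩ := hw
      exact Finset.mem_biUnion.2 ⟨a, ha, Finset.mem_erase.2 ⟨hzy, mem_nb.2 ⟨a, by simp, hwz⟩⟩⟩)
  obtain ⟨f, hf, hfm⟩ := hhall
  have hfm' : ∀ a, f a ≠ y ∧ G.Adj a.1 (f a) := by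
    intro a
    have := hfm a
    simpa [a.2.1] using this
  obtain ⟨g, hgx, hg⟩ : ∃ g : V → V, g x = y ∧ ∀ a (ha : a ∈ A ∧ a ≠ x), g a = f ⟨a, ha⟩ :=
    ⟨fun a => if ha : a ∈ A ∧ a ≠ x then f ⟨a, ha⟩ else y, by simp, fun a ha => by simp [ha]⟩
  have hgadj : ∀ a ∈ A, G.Adj a (g a) := by
    intro a ha
    by_cases hax : a = x
    · rw [hax, hgx]; exact hxy
    · rw [hg a ⟨ha, hax⟩]; exact (hfm' ⟨a, ha, hax⟩).2
  have hginj : Set.InjOn g A := by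
    intro a ha a' ha' heq
    by_cases hax : a = x <;> by_cases hax' : a' = x
    · rw [hax, hax']
    · rw [hax, hgx, hg a' ⟨ha', hax'⟩] at heq
      exact absurd heq.symm (hfm' _).1
    · rw [hax', hgx, hg a ⟨ha, hax⟩] at heq
      exact absurd heq (hfm' _).1
    · rw [hg a ⟨ha, hax⟩, hg a' ⟨ha', hax'⟩] at heq
      exact congrArg Subtype.val (hf heq)
  have hgB : ∀ a ∈ A, g a ∈ Aᶜ := fun a ha =>
    (h.sub a (g a) (by simpa using ⟨ha, hgadj a ha⟩)).2
  have hgsurj : ∀ b ∈ Aᶜ, ∃ a ∈ A, g a = b := by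
    intro b hb
    have himg : A.image g = Aᶜ := Finset.eq_of_subset_of_card_le
      (Finset.image_subset_iff.2 hgB)
      (by rw [Finset.card_image_of_injOn hginj]; exact h.card_eq.ge)
    rw [← himg] at hb
    simpa using hb
  let M : G.Subgraph :=
    { verts := Set.univ
      Adj := fun u v => (u ∈ A ∧ g u = v) ∨ (v ∈ A ∧ g v = u)
      adj_sub := by
        rintro u v (⟨hu, rfl⟩ | ⟨hv, rfl⟩)
        · exact hgadj u hu
        · exact (hgadj v hv).symm
      edge_vert := fun _ => Set.mem_univ _
      symm := ⟨fun u v huv => huv.symm⟩ }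
  refine ⟨M, ?_, Or.inl ⟨hx, hgx⟩⟩
  rw [Subgraph.isPerfectMatching_iff]
  intro v
  by_cases hv : v ∈ A
  · refine ⟨g v, Or.inl ⟨hv, rfl⟩, ?_⟩
    rintro w (⟨-, hw⟩ | ⟨hw, hwv⟩)
    · exact hw.symm
    · have := hgB w hw
      rw [hwv] at this
      exact absurd hv (Finset.mem_compl.1 this)
  · obtain ⟨a, ha, hav⟩ := hgsurj v (Finset.mem_compl.2 hv)
    refine ⟨a, Or.inr ⟨ha, hav⟩, ?_⟩
    rintro w (⟨hv', -⟩ | ⟨hw, hwv⟩)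
    · exact absurd hv' hv
    · exact hginj hw ha (hwv.trans hav.symm)

theorem matchingCovered_of_surplus {G : SimpleGraph V} {A : Finset V}
    (hA : ∀ u v, G.Adj u v → (u ∈ A ↔ v ∉ A)) (h : Surplus A Aᶜ (orientedEdges G A)) :
    MatchingCovered G := by
  refine ⟨connected_of_surplus h, ?_, ?_⟩
  · have := Finset.card_add_card_compl A
    have := h.two_le
    have := h.card_eq
    omega
  · intro e he
    induction e using Sym2.ind with
    | _ x y =>
    have hxy : G.Adj x y := he
    by_cases hx : x ∈ A
    · exact exists_perfectMatching_of_surplus h hx hxy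
    · obtain ⟨M, hM, hadj⟩ := exists_perfectMatching_of_surplus h
        (not_not.1 fun hy => hx ((hA x y hxy).2 hy)) hxy.symm
      exact ⟨M, hM, M.adj_symm hadj⟩

theorem orientedEdges_deleteEdges {G : SimpleGraph V} {A : Finset V}
    (hA : ∀ u v, G.Adj u v → (u ∈ A ↔ v ∉ A)) {a b : V} (ha : a ∈ A) (hab : G.Adj a b) :
    orientedEdges (G.deleteEdges {s(a, b)}) A = (orientedEdges G A).erase (a, b) := by
  ext ⟨x, y⟩
  simp only [mem_orientedEdges, deleteEdges_adj, Finset.mem_erase, Set.mem_singleton_iff,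
    Sym2.eq_iff, Prod.mk.injEq, ne_eq]
  have := (hA a b hab).1 ha
  constructor
  · rintro ⟨hx, hxy, hn⟩
    exact ⟨fun h => hn (Or.inl h), hx, hxy⟩
  · rintro ⟨hn, hx, hxy⟩
    refine ⟨hx, hxy, ?_⟩
    rintro (h | ⟨rfl, rfl⟩)
    · exact hn h
    · exact this hx

theorem minSurplus_of_minimalMatchingCovered {G : SimpleGraph V} {A : Finset V}
    (hA : ∀ u v, G.Adj u v → (u ∈ A ↔ v ∉ A)) (h : MinimalMatchingCovered G) :
    MinSurplus A Aᶜ (orientedEdges G A) := by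
  have hs := surplus_of_matchingCovered hA h.1
  refine ⟨hs, fun a b hab => ?_⟩
  obtain ⟨ha, hadj⟩ : a ∈ A ∧ G.Adj a b := mem_orientedEdges.1 hab
  by_contra! hcon
  refine h.2 s(a, b) hadj (matchingCovered_of_surplus (A := A)
    (fun u v huv => hA u v (deleteEdges_adj.1 huv).1) ?_)
  rw [orientedEdges_deleteEdges hA ha hadj]
  refine ⟨fun x y hxy => hs.sub x y (Finset.mem_of_mem_erase hxy), hs.card_eq, hs.two_le, ?_⟩
  intro X hXA hXn hXne
  have hlt := hs.hall X hXA hXn hXne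
  by_cases hu : a ∈ X ∧ ∀ x ∈ X, (x, b) ∈ orientedEdges G A → x = a
  · have hbig : X.card + 1 < (nb (orientedEdges G A) X).card := by
      by_contra hle
      exact hcon X ⟨hXA, hu.1, hXne, by omega, hu.2⟩
    have hsub : (nb (orientedEdges G A) X).erase b ⊆
        nb ((orientedEdges G A).erase (a, b)) X := by
      intro y hy
      obtain ⟨hyb, hy⟩ := Finset.mem_erase.1 hy
      obtain ⟨x, hx, hxy⟩ := mem_nb.1 hy
      exact mem_nb.2 ⟨x, hx, Finset.mem_erase.2 ⟨fun e => hyb (congrArg Prod.snd e), hxy⟩⟩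
    have c := Finset.card_le_card hsub
    have := Finset.pred_card_le_card_erase (a := b) (s := nb (orientedEdges G A) X)
    omega
  · refine hlt.trans_le (Finset.card_le_card fun y hy => ?_)
    obtain ⟨x, hx, hxy⟩ := mem_nb.1 hy
    by_cases he : (x, y) = (a, b)
    · obtain ⟨rfl, rfl⟩ := Prod.mk.injEq _ _ _ _ ▸ he
      have : ∃ z ∈ X, (z, y) ∈ orientedEdges G A ∧ z ≠ x := by
        by_contra! hno
        exact hu ⟨hx, hno⟩
      obtain ⟨z, hz, hzy, hne⟩ := this
      exact mem_nb.2 ⟨z, hz, Finset.mem_erase.2 ⟨fun e => hne (congrArg Prod.fst e), hzy⟩⟩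
    · exact mem_nb.2 ⟨x, hx, Finset.mem_erase.2 ⟨he, hxy⟩⟩

theorem degL_orientedEdges {G : SimpleGraph V} {A : Finset V} {a : V} (ha : a ∈ A) :
    degL (orientedEdges G A) a = degN G a := by
  rw [← card_nb_singleton, degN, ← Set.ncard_coe_finset]
  congr 1
  ext b
  simp [ha]

theorem degR_orientedEdges {G : SimpleGraph V} {A : Finset V}
    (hA : ∀ u v, G.Adj u v → (u ∈ A ↔ v ∉ A)) {b : V} (hb : b ∉ A) :
    degR (orientedEdges G A) b = degN G b := by
  rw [← degL_swapEdges, ← card_nb_singleton, degN, ← Set.ncard_coe_finset]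
  congr 1
  ext a
  simp only [Finset.mem_coe, mem_nb, Finset.mem_singleton, exists_eq_left, mem_swapEdges,
    mem_orientedEdges, mem_neighborSet]
  exact ⟨fun h => h.2.symm, fun h => ⟨(hA a b h.symm).2 hb, h.symm⟩⟩

theorem card_twoEdges_le {G : SimpleGraph V} {A : Finset V}
    (hA : ∀ u v, G.Adj u v → (u ∈ A ↔ v ∉ A)) :
    (twoEdges (orientedEdges G A)).card ≤ {e | IsTwoEdge G e}.ncard := by
  have hinj : Set.InjOn (fun e : V × V => s(e.1, e.2))
      (twoEdges (orientedEdges G A) : Set (V × V)) := by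
    rintro ⟨a, b⟩ hab ⟨a', b'⟩ hab' heq
    simp only [twoEdges, Finset.coe_filter, Set.mem_ofPred_eq, mem_orientedEdges] at hab hab'
    rcases Sym2.eq_iff.1 heq with ⟨rfl, rfl⟩ | ⟨rfl, rfl⟩
    · rfl
    · exact absurd hab'.1.1 ((hA _ _ hab.1.2).1 hab.1.1)
  rw [← Set.ncard_coe_finset, ← hinj.ncard_image]
  refine Set.ncard_le_ncard ?_ (Set.toFinite _)
  rintro _ ⟨⟨a, b⟩, hab, rfl⟩
  simp only [twoEdges, Finset.coe_filter, Set.mem_ofPred_eq, mem_orientedEdges] at hab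
  obtain ⟨⟨ha, hadj⟩, hda, hdb⟩ := hab
  refine ⟨hadj, fun v hv => ?_⟩
  rcases Sym2.mem_iff.1 hv with rfl | rfl
  · rw [← degL_orientedEdges ha, hda]
  · rw [← degR_orientedEdges hA ((hA _ _ hadj).1 ha), hdb]

end Graph

end BipartiteEdges

/-- A minimal bipartite matching covered graph has at least `(n + 10)/6` 2-edges. -/
theorem stmt4 {V : Type*} [Fintype V] (G : SimpleGraph V)
    (hbip : G.Colorable 2) (hmin : MinimalMatchingCovered G) :
    6 * {e | IsTwoEdge G e}.ncard ≥ Fintype.card V + 10 := by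
  classical
  obtain ⟨c⟩ := hbip
  have hA : ∀ u v, G.Adj u v → (u ∈ Finset.univ.filter (fun v => c v = 0) ↔
      v ∉ Finset.univ.filter (fun v => c v = 0)) := by
    intro u v huv
    have := c.valid huv
    simp only [Finset.mem_filter, Finset.mem_univ, true_and]
    omega
  have key := (BipartiteEdges.minSurplus_of_minimalMatchingCovered hA hmin).card_add_ten_le
  rw [Finset.card_add_card_compl] at key
  have := BipartiteEdges.card_twoEdges_le hA
  omega
end

section
/- Let G be a minimal bipartite matching covered graph, not isomorphic to the cycle graph on 4 vertices, satisfying |V2| = 2(m − n + 2). Then every vertex of G of degree 2 has exactly one neighbour of degree 2 (so the set of 2-edges forms a perfect matching of the subgraph induced by the degree-2 vertices), and the number of 2-edges equals m − n + 2, i.e. |E2| + n = m + 2. Here n is the number of vertices, m the number of edges, V2 the set of degree-2 vertices, and E2 the set of 2-edges of G. -/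
open SimpleGraph

namespace BipRel

open Finset
open scoped Classical

section Basic

variable {α β : Type*} [Fintype α] {R : α → β → Prop}

/-- The vertices of the left class adjacent to some vertex of `W`. -/
noncomputable def nbrs (R : α → β → Prop) (W : Finset β) : Finset α :=
  univ.filter fun a => ∃ b ∈ W, R a b

@[simp] lemma mem_nbrs {W : Finset β} {a : α} : a ∈ nbrs R W ↔ ∃ b ∈ W, R a b := by
  simp [nbrs]

lemma nbrs_mono {W W' : Finset β} (h : W ⊆ W') : nbrs R W ⊆ nbrs R W' := by
  intro a ha
  obtain ⟨b, hb, hab⟩ := mem_nbrs.1 ha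
  exact mem_nbrs.2 ⟨b, h hb, hab⟩

lemma nbrs_union (W W' : Finset β) : nbrs R (W ∪ W') = nbrs R W ∪ nbrs R W' := by
  ext a
  simp only [mem_nbrs, mem_union, or_and_right, exists_or]

lemma nbrs_inter_subset (W W' : Finset β) : nbrs R (W ∩ W') ⊆ nbrs R W ∩ nbrs R W' :=
  subset_inter (nbrs_mono inter_subset_left) (nbrs_mono inter_subset_right)

variable [Fintype β]

/-- The degree of a vertex of the left class. -/
noncomputable def deg (R : α → β → Prop) (a : α) : ℕ :=
  (univ.filter fun b => R a b).card

/-- Hall-type description of bipartite matching covered graphs. -/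
structure IsMC (R : α → β → Prop) : Prop where
  card_eq : Fintype.card α = Fintype.card β
  two_le : 2 ≤ Fintype.card β
  surplus : ∀ W : Finset β, W.Nonempty → W ≠ univ → W.card < (nbrs R W).card

/-- A set witnessing that deleting the edge `ab` destroys the surplus condition. -/
def IsTight (R : α → β → Prop) (a : α) (b : β) (W : Finset β) : Prop :=
  b ∈ W ∧ (∀ y ∈ W, R a y → y = b) ∧ (nbrs R W).card ≤ W.card + 1

/-- Hall-type description of minimal bipartite matching covered graphs. -/
structure IsMinMC (R : α → β → Prop) : Prop extends IsMC R where
  tight : ∀ a b, R a b → ∃ W, IsTight R a b W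

lemma IsMC.two_le_deg (h : IsMC R) (a : α) : 2 ≤ deg R a := by
  by_contra! hlt
  obtain ⟨b, hb⟩ : ∃ b, ∀ y, R a y → y = b := by
    have := Finset.card_le_one.1 (Nat.lt_succ_iff.1 hlt)
    by_cases hn : ∃ b, R a b
    · obtain ⟨b, hb⟩ := hn
      exact ⟨b, fun y hy => this y (by simpa using hy) b (by simpa using hb)⟩
    · have : Nonempty β := Fintype.card_pos_iff.1 (by have := h.two_le; omega)
      exact ⟨this.some, fun y hy => (hn ⟨y, hy⟩).elim⟩
  have hc : (univ.erase b).card = Fintype.card β - 1 := by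
    rw [card_erase_of_mem (mem_univ b), card_univ]
  have h2 := h.two_le
  have hs := h.surplus (univ.erase b) (by rw [← card_pos]; omega)
    (fun he => by have := mem_univ b; rw [← he] at this; simp at this)
  have hsub : nbrs R (univ.erase b) ⊆ univ.erase a := by
    intro x hx
    obtain ⟨y, hy, hxy⟩ := mem_nbrs.1 hx
    refine mem_erase.2 ⟨?_, mem_univ _⟩
    rintro rfl
    exact (mem_erase.1 hy).1 (hb y hxy)
  have hle := card_le_card hsub
  rw [card_erase_of_mem (mem_univ a), card_univ] at hle
  have := h.card_eq
  omega

lemma IsMC.exists_ne (h : IsMC R) (a : α) (b : β) : ∃ y, y ≠ b ∧ R a y := by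
  obtain ⟨y, hy, hne⟩ := exists_mem_ne (h.two_le_deg a) b
  exact ⟨y, hne, by simpa using hy⟩

lemma IsTight.ne_univ (h : IsMC R) {a : α} {b : β} {W : Finset β} (hW : IsTight R a b W) :
    W ≠ univ := by
  rintro rfl
  obtain ⟨y, hy, hay⟩ := h.exists_ne a b
  exact hy (hW.2.1 y (mem_univ _) hay)

lemma IsMC.inter_lt (h : IsMC R) {W W' : Finset β} (hn : (W ∩ W').Nonempty) (hW : W ≠ univ) :
    (W ∩ W').card < (nbrs R (W ∩ W')).card :=
  h.surplus _ hn fun he => hW (by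
    rw [← univ_subset_iff, ← he]; exact inter_subset_left)

/-- Tight sets of two edges at a vertex of degree at least three share no other neighbour. -/
lemma IsMC.tight_disjoint (h : IsMC R) {a : α} {b b' : β} (hd : 3 ≤ deg R a) (hb : R a b)
    (hb' : R a b') (hne : b ≠ b') {W W' : Finset β} (hW : IsTight R a b W)
    (hW' : IsTight R a b' W') {x : α} (hx : x ∈ nbrs R W) (hx' : x ∈ nbrs R W') : x = a := by
  by_contra hxa
  have haW : a ∈ nbrs R W := mem_nbrs.2 ⟨b, hW.1, hb⟩
  have haW' : a ∈ nbrs R W' := mem_nbrs.2 ⟨b', hW'.1, hb'⟩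
  have hai : a ∉ nbrs R (W ∩ W') := by
    intro ha
    obtain ⟨y, hy, hay⟩ := mem_nbrs.1 ha
    rw [mem_inter] at hy
    exact hne ((hW.2.1 y hy.1 hay).symm.trans (hW'.2.1 y hy.2 hay))
  have hkey : (W ∩ W').card + 2 ≤ (nbrs R W ∩ nbrs R W').card := by
    rcases (W ∩ W').eq_empty_or_nonempty with he | hn
    · rw [he, card_empty, zero_add]
      have : ({x, a} : Finset α) ⊆ nbrs R W ∩ nbrs R W' := by
        intro z hz
        rcases mem_insert.1 hz with rfl | hz
        · exact mem_inter.2 ⟨hx, hx'⟩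
        · rw [mem_singleton.1 hz]; exact mem_inter.2 ⟨haW, haW'⟩
      simpa [card_pair hxa] using card_le_card this
    · have h1 := h.inter_lt hn (hW.ne_univ h)
      have h2 : insert a (nbrs R (W ∩ W')) ⊆ nbrs R W ∩ nbrs R W' :=
        insert_subset (mem_inter.2 ⟨haW, haW'⟩) (nbrs_inter_subset W W')
      have h3 := card_le_card h2
      rw [card_insert_of_notMem hai] at h3
      omega
  have hU : W ∪ W' = univ := by
    by_contra hU
    have h1 := h.surplus (W ∪ W') ⟨b, mem_union_left _ hW.1⟩ hU
    rw [nbrs_union] at h1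
    have h2 := card_union_add_card_inter W W'
    have h3 := card_union_add_card_inter (nbrs R W) (nbrs R W')
    have h4 := hW.2.2
    have h5 := hW'.2.2
    omega
  have hsub : (univ.filter fun y => R a y) ⊆ {b, b'} := by
    intro y hy
    have hay : R a y := by simpa using hy
    have hyU : y ∈ W ∪ W' := hU ▸ mem_univ y
    rcases mem_union.1 hyU with hy | hy
    · simp [hW.2.1 y hy hay]
    · simp [hW'.2.1 y hy hay]
  have := (card_le_card hsub).trans card_le_two
  unfold deg at hd
  omega

/-- Along a path `a b a' b'` with `a'` of degree at least three, tight sets of `a'b'` can be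
absorbed by tight sets of `ab`. -/
lemma IsMinMC.tight_union (h : IsMinMC R) {a a' : α} {b b' : β} (ha : a ≠ a')
    (hbb : b ≠ b') (hab : R a b) (hb : R a' b) (hb' : R a' b') (hd : 3 ≤ deg R a')
    {W W' : Finset β} (hW : IsTight R a b W) (hW' : IsTight R a' b' W') :
    a ∉ nbrs R W' ∧ IsTight R a b (W ∪ W') := by
  obtain ⟨W₁, hW₁⟩ := h.tight a' b hb
  have haW' : a ∉ nbrs R W' := fun hc =>
    ha (h.tight_disjoint hd hb hb' hbb hW₁ hW' (mem_nbrs.2 ⟨b, hW₁.1, hab⟩) hc)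
  refine ⟨haW', mem_union_left _ hW.1, ?_, ?_⟩
  · intro y hy hay
    rcases mem_union.1 hy with hy | hy
    · exact hW.2.1 y hy hay
    · exact (haW' (mem_nbrs.2 ⟨y, hy, hay⟩)).elim
  · have hkey : (W ∩ W').card + 1 ≤ (nbrs R W ∩ nbrs R W').card := by
      rcases (W ∩ W').eq_empty_or_nonempty with he | hn
      · rw [he, card_empty, zero_add]
        exact card_pos.2 ⟨a', mem_inter.2 ⟨mem_nbrs.2 ⟨b, hW.1, hb⟩, mem_nbrs.2 ⟨b', hW'.1, hb'⟩⟩⟩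
      · exact (h.inter_lt hn (hW.ne_univ h.toIsMC)).trans_le
          (card_le_card (nbrs_inter_subset W W'))
    rw [nbrs_union]
    have h2 := card_union_add_card_inter W W'
    have h3 := card_union_add_card_inter (nbrs R W) (nbrs R W')
    have h4 := hW.2.2
    have h5 := hW'.2.2
    omega

/-- A tight set of largest size for the edge `ab`. -/
def IsMaxTight (R : α → β → Prop) (a : α) (b : β) (W : Finset β) : Prop :=
  IsTight R a b W ∧ ∀ W', IsTight R a b W' → W'.card ≤ W.card

lemma IsMinMC.exists_maxTight (h : IsMinMC R) {a : α} {b : β} (hab : R a b) :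
    ∃ W, IsMaxTight R a b W := by
  obtain ⟨W₀, hW₀⟩ := h.tight a b hab
  obtain ⟨W, hW, hmax⟩ := exists_max_image (univ.filter fun W => IsTight R a b W) card
    ⟨W₀, by simpa using hW₀⟩
  exact ⟨W, by simpa using hW, fun W' hW' => hmax W' (by simpa using hW')⟩

lemma IsMinMC.maxTight_subset (h : IsMinMC R) {a a' : α} {b b' : β} (ha : a ≠ a')
    (hbb : b ≠ b') (hab : R a b) (hb : R a' b) (hb' : R a' b') (hd : 3 ≤ deg R a')
    {W W' : Finset β} (hW : IsMaxTight R a b W) (hW' : IsTight R a' b' W') : W' ⊂ W := by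
  have hu := (h.tight_union ha hbb hab hb hb' hd hW.1 hW').2
  have heq : W = W ∪ W' := eq_of_subset_of_card_le subset_union_left (hW.2 _ hu)
  refine ⟨fun y hy => heq ▸ mem_union_right _ hy, fun hc => ?_⟩
  exact hbb (hW'.2.1 b (hc hW.1.1) hb)

/-- No nonempty edge set of minimum degree two has at most one left vertex of degree two. -/
lemma IsMinMC.no_cycle (h : IsMinMC R) (E : Finset (α × β)) (hE : ∀ p ∈ E, R p.1 p.2)
    (a₀ : α) (b₀ : β) (h0 : (a₀, b₀) ∈ E) (hdeg : ∀ p ∈ E, p.1 ≠ a₀ → 3 ≤ deg R p.1)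
    (hl : ∀ a b, (a, b) ∈ E → ∃ b', b' ≠ b ∧ (a, b') ∈ E)
    (hr : ∀ a b, (a, b) ∈ E → ∃ a', a' ≠ a ∧ (a', b) ∈ E) : False := by
  have main : ∀ (n : ℕ) (a : α) (b : β) (W : Finset β), (a, b) ∈ E → IsMaxTight R a b W →
      (a₀ ∈ nbrs R W → a₀ = a) → W.card = n → False := by
    intro n
    induction n using Nat.strong_induction_on with
    | _ n ih =>
      intro a b W hp hW h0W hn
      obtain ⟨a', ha', hp'⟩ := hr a b hp
      obtain ⟨b', hb', hp''⟩ := hl a' b hp'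
      have hne : a' ≠ a₀ := by
        rintro rfl
        exact ha' (h0W (mem_nbrs.2 ⟨b, hW.1.1, hE _ hp'⟩))
      have hd := hdeg _ hp' hne
      obtain ⟨W', hW'⟩ := h.exists_maxTight (hE _ hp'')
      have hss := h.maxTight_subset ha'.symm hb'.symm (hE _ hp) (hE _ hp') (hE _ hp'') hd hW hW'.1
      have hna := (h.tight_union ha'.symm hb'.symm (hE _ hp) (hE _ hp') (hE _ hp'') hd hW.1
        hW'.1).1
      refine ih W'.card (hn ▸ card_lt_card hss) a' b' W' hp'' hW' (fun hc => ?_) rfl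
      have := h0W (nbrs_mono hss.1 hc)
      exact (hna (this ▸ hc)).elim
  obtain ⟨W, hW⟩ := h.exists_maxTight (hE _ h0)
  exact main _ a₀ b₀ W h0 hW (fun _ => rfl) rfl

/-- An edge set with at most one left vertex of degree two is a forest, in numbers. -/
lemma IsMinMC.card_lt_of_forest (h : IsMinMC R) (a₀ : α) (E : Finset (α × β))
    (hne : E.Nonempty) (hE : ∀ p ∈ E, R p.1 p.2)
    (hdeg : ∀ p ∈ E, p.1 ≠ a₀ → 3 ≤ deg R p.1) :
    E.card < (E.image Prod.fst).card + (E.image Prod.snd).card := by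
  induction E using Finset.strongInduction with
  | _ E ih =>
    have key : ∀ p ∈ E, ((∀ q ∈ E, q.1 = p.1 → q = p) ∨ (∀ q ∈ E, q.2 = p.2 → q = p)) →
        E.card < (E.image Prod.fst).card + (E.image Prod.snd).card := by
      intro p hp hor
      have hfst : 0 < (E.image Prod.fst).card := card_pos.2 (hne.image _)
      have hsnd : 0 < (E.image Prod.snd).card := card_pos.2 (hne.image _)
      have hc := card_erase_add_one hp
      rcases (E.erase p).eq_empty_or_nonempty with he | hne'
      · rw [he, card_empty] at hc
        omega
      · have hi := ih _ (erase_ssubset hp) hne' (fun q hq => hE q (mem_of_mem_erase hq))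
          (fun q hq => hdeg q (mem_of_mem_erase hq))
        have h1 := card_le_card (image_subset_image (f := Prod.fst) (erase_subset p E))
        have h2 := card_le_card (image_subset_image (f := Prod.snd) (erase_subset p E))
        rcases hor with hu | hu
        · have : ((E.erase p).image Prod.fst).card < (E.image Prod.fst).card := by
            refine card_lt_card ⟨image_subset_image (erase_subset p E), fun hc => ?_⟩
            obtain ⟨q, hq, hqp⟩ := mem_image.1 (hc (mem_image_of_mem _ hp))
            exact (mem_erase.1 hq).1 (hu q (mem_of_mem_erase hq) hqp)
          omega
        · have : ((E.erase p).image Prod.snd).card < (E.image Prod.snd).card := by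
            refine card_lt_card ⟨image_subset_image (erase_subset p E), fun hc => ?_⟩
            obtain ⟨q, hq, hqp⟩ := mem_image.1 (hc (mem_image_of_mem _ hp))
            exact (mem_erase.1 hq).1 (hu q (mem_of_mem_erase hq) hqp)
          omega
    by_contra hcon
    have hl : ∀ a b, (a, b) ∈ E → ∃ b', b' ≠ b ∧ (a, b') ∈ E := by
      intro a b hab
      by_contra! hx
      refine hcon (key _ hab (Or.inl ?_))
      rintro ⟨c, d⟩ hq rfl
      by_contra hqe
      exact hx d (fun hd => hqe (by rw [hd])) hq
    have hr : ∀ a b, (a, b) ∈ E → ∃ a', a' ≠ a ∧ (a', b) ∈ E := by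
      intro a b hab
      by_contra! hx
      refine hcon (key _ hab (Or.inr ?_))
      rintro ⟨c, d⟩ hq rfl
      by_contra hqe
      exact hx c (fun hd => hqe (by rw [hd])) hq
    by_cases h0 : ∃ b, (a₀, b) ∈ E
    · obtain ⟨b, hb⟩ := h0
      exact h.no_cycle E hE a₀ b hb hdeg hl hr
    · obtain ⟨⟨a, b⟩, hab⟩ := hne
      refine h.no_cycle E hE a b hab (fun p hp _ => hdeg p hp ?_) hl hr
      rintro rfl
      exact h0 ⟨p.2, hp⟩

/-- The number of edges. -/
noncomputable def edgeCount (R : α → β → Prop) : ℕ := ∑ a, deg R a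

/-- The vertices of degree two in the left class. -/
noncomputable def twos (R : α → β → Prop) : Finset α := univ.filter fun a => deg R a = 2

/-- The Lovász–Plummer bound for one colour class. -/
theorem IsMinMC.edgeCount_le (h : IsMinMC R) :
    edgeCount R + 2 ≤ (twos R).card + (Fintype.card α + Fintype.card β) := by
  have hpos : 0 < Fintype.card α := by have := h.card_eq; have := h.two_le; omega
  have bound : ∀ (a₀ : α) (S : Finset α), a₀ ∈ S → (∀ a ∈ S, a ≠ a₀ → 3 ≤ deg R a) →
      ∑ a ∈ S, deg R a < S.card + Fintype.card β := by
    intro a₀ S h₀ hS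
    have hcard : ((S ×ˢ univ).filter fun p : α × β => R p.1 p.2).card = ∑ a ∈ S, deg R a := by
      rw [card_filter, sum_product]
      refine sum_congr rfl fun a _ => ?_
      rw [deg, card_filter]
    have hlt := h.card_lt_of_forest a₀ ((S ×ˢ univ).filter fun p : α × β => R p.1 p.2) ?_ ?_ ?_
    · rw [hcard] at hlt
      refine hlt.trans_le (add_le_add (card_le_card ?_) (card_le_univ _))
      intro x hx
      obtain ⟨p, hp, rfl⟩ := mem_image.1 hx
      exact (mem_product.1 (mem_filter.1 hp).1).1
    · rw [← card_pos, hcard]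
      exact sum_pos (fun a _ => by have := h.two_le_deg a; omega) ⟨a₀, h₀⟩
    · exact fun p hp => (mem_filter.1 hp).2
    · exact fun p hp hne => hS _ (mem_product.1 (mem_filter.1 hp).1).1 hne
  have hge : ∀ a, a ∉ twos R → 3 ≤ deg R a := by
    intro a ha
    have h1 := h.two_le_deg a
    have h2 : deg R a ≠ 2 := by simpa [twos] using ha
    omega
  rcases (twos R).eq_empty_or_nonempty with he | ⟨a₀, h₀⟩
  · obtain ⟨a₀⟩ := Fintype.card_pos_iff.1 hpos
    have h1 := bound a₀ univ (mem_univ _) (fun a _ _ => hge a (by simp [he]))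
    have h2 : (univ : Finset α).card * 2 ≤ ∑ a, deg R a :=
      card_nsmul_le_sum _ _ _ fun a _ => h.two_le_deg a
    have := h.card_eq
    rw [card_univ] at h1 h2
    omega
  · have h1 := bound a₀ (insert a₀ (twos R)ᶜ) (mem_insert_self _ _) (fun a ha hne =>
      hge a (mem_compl.1 ((mem_insert.1 ha).resolve_left hne)))
    have hn : a₀ ∉ (twos R)ᶜ := by simpa using h₀
    rw [sum_insert hn, card_insert_of_notMem hn, card_compl] at h1
    have h2 := sum_add_sum_compl (twos R) (deg R)
    have h3 : ∑ a ∈ twos R, deg R a = (twos R).card * 2 := by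
      rw [sum_const_nat]; intro a ha; exact (mem_filter.1 ha).2
    have h4 := (mem_filter.1 h₀).2
    have h5 := card_le_univ (twos R)
    unfold edgeCount
    omega

/-! ### Interchanging the colour classes -/

lemma IsMC.swap (h : IsMC R) : IsMC (flip R) where
  card_eq := h.card_eq.symm
  two_le := h.card_eq ▸ h.two_le
  surplus := by
    intro X hX hXu
    have hcard := h.card_eq
    rcases eq_or_ne (nbrs (Function.swap R) X) univ with he | hne
    · have : X.card < Fintype.card α := by
        rw [← card_univ]; exact card_lt_card (ssubset_univ_iff.2 hXu)
      change X.card < (nbrs (Function.swap R) X).card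
      rw [he, card_univ]
      omega
    · change X.card < (nbrs (Function.swap R) X).card
      have hs := h.surplus (nbrs (Function.swap R) X)ᶜ ?_ ?_
      · have hsub : nbrs R (nbrs (Function.swap R) X)ᶜ ⊆ Xᶜ := by
          intro a ha
          obtain ⟨b, hb, hab⟩ := mem_nbrs.1 ha
          rw [mem_compl] at hb ⊢
          exact fun hc => hb (mem_nbrs.2 ⟨a, hc, hab⟩)
        have := card_le_card hsub
        rw [card_compl] at this hs
        have := card_le_univ X
        have := card_le_univ (nbrs (Function.swap R) X)
        omega
      · rw [nonempty_iff_ne_empty]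
        exact fun hc => hne (compl_eq_empty_iff _ |>.1 hc)
      · intro hc
        obtain ⟨a, ha⟩ := hX
        obtain ⟨b, -, hab⟩ := h.exists_ne a (Fintype.card_pos_iff.1 (by have := h.two_le; omega)).some
        have hb : b ∈ nbrs (Function.swap R) X := mem_nbrs.2 ⟨a, ha, hab⟩
        have := mem_univ b
        rw [← hc, mem_compl] at this
        exact this hb

lemma IsMinMC.swap (h : IsMinMC R) : IsMinMC (flip R) where
  toIsMC := h.toIsMC.swap
  tight := by
    intro b a hab
    obtain ⟨W, hW⟩ := h.tight a b hab
    have haW : a ∈ nbrs R W := mem_nbrs.2 ⟨b, hW.1, hab⟩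
    refine ⟨((nbrs R W).erase a)ᶜ, by simp, ?_, ?_⟩
    · intro x hx hxb
      by_contra hne
      exact mem_compl.1 hx (mem_erase.2 ⟨hne, mem_nbrs.2 ⟨b, hW.1, hxb⟩⟩)
    · have hsub : nbrs (Function.swap R) ((nbrs R W).erase a)ᶜ ⊆ insert b Wᶜ := by
        intro y hy
        obtain ⟨x, hx, hxy⟩ := mem_nbrs.1 hy
        by_cases hyW : y ∈ W
        · have hxa : x = a := by
            by_contra hne
            exact mem_compl.1 hx (mem_erase.2 ⟨hne, mem_nbrs.2 ⟨y, hyW, hxy⟩⟩)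
          subst hxa
          rw [hW.2.1 y hyW hxy]
          exact mem_insert_self _ _
        · exact mem_insert_of_mem (mem_compl.2 hyW)
      have h1 := (card_le_card hsub).trans (card_insert_le _ _)
      rw [card_compl] at h1
      change (nbrs (Function.swap R) _).card ≤ _
      rw [card_compl, card_erase_of_mem haW]
      have := hW.2.2
      have := h.card_eq
      have := card_le_univ W
      have := card_le_univ (nbrs R W)
      have := card_pos.2 ⟨a, haW⟩
      omega

lemma edgeCount_flip (R : α → β → Prop) : edgeCount (flip R) = edgeCount R :=
  (sum_card_bipartiteAbove_eq_sum_card_bipartiteBelow (s := univ) (t := univ) R).symm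

end Basic


/-! ### Contracting a vertex of degree two -/

section Merge

lemma eq_or_eq_of_deg_eq_two {α β : Type*} [Fintype β] {R : α → β → Prop}
    {a : α} {b b' : β} (hd : deg R a = 2) (hne : b ≠ b')
    (hb : R a b) (hb' : R a b') {z : β} (hz : R a z) : z = b ∨ z = b' := by
  have hsub : ({b, b'} : Finset β) ⊆ univ.filter fun y => R a y := by
    intro y hy
    rcases mem_insert.1 hy with rfl | hy
    · simpa using hb
    · rw [mem_singleton.1 hy]; simpa using hb'
  have heq := eq_of_subset_of_card_le hsub (by rw [card_pair hne]; exact hd.le)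
  have : z ∈ ({b, b'} : Finset β) := heq ▸ (by simpa using hz)
  simpa using this

variable {α β : Type*} [Fintype α] {R : α → β → Prop}

lemma card_nbrs_singleton (R : α → β → Prop) (y : β) : (nbrs R {y}).card = deg (flip R) y := by
  unfold nbrs deg
  congr 1
  ext a
  rw [mem_filter, mem_filter]
  simp [flip]

/-- Delete the right vertex `b` and merge the left vertex `a'` into `a`. -/
def mergeRel (R : α → β → Prop) (a a' : α) (b : β) (x : {x : α // x ≠ a'}) (y : {y : β // y ≠ b}) :
    Prop :=
  R x y ∨ (x.1 = a ∧ R a' y)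

variable {a a' : α} {b : β}

lemma nbrs_insert_of_iff (hb : ∀ x, R x b ↔ x = a ∨ x = a') (W : Finset β) :
    nbrs R (insert b W) = insert a (insert a' (nbrs R W)) := by
  ext x
  simp only [mem_nbrs, mem_insert, exists_eq_or_imp, hb, or_assoc]

lemma map_nbrs_merge_of_notMem (W : Finset {y : β // y ≠ b})
    (ha' : a' ∉ nbrs R (W.map (Function.Embedding.subtype _))) :
    (nbrs (mergeRel R a a' b) W).map (Function.Embedding.subtype _) =
      nbrs R (W.map (Function.Embedding.subtype _)) := by
  ext x
  simp only [mem_map, mem_nbrs, Function.Embedding.coe_subtype] at ha' ⊢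
  constructor
  · rintro ⟨x, ⟨y, hy, hxy | ⟨-, hxy⟩⟩, rfl⟩
    · exact ⟨y, ⟨y, hy, rfl⟩, hxy⟩
    · exact (ha' ⟨y, ⟨y, hy, rfl⟩, hxy⟩).elim
  · rintro ⟨_, ⟨y, hy, rfl⟩, hxy⟩
    have hx : x ≠ a' := by
      rintro rfl
      exact ha' ⟨y, ⟨y, hy, rfl⟩, hxy⟩
    exact ⟨⟨x, hx⟩, ⟨y, hy, Or.inl hxy⟩, rfl⟩

lemma map_nbrs_merge_of_mem (hne : a ≠ a') (W : Finset {y : β // y ≠ b})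
    (hmem : a ∈ nbrs R (W.map (Function.Embedding.subtype _)) ∨
      a' ∈ nbrs R (W.map (Function.Embedding.subtype _))) :
    (nbrs (mergeRel R a a' b) W).map (Function.Embedding.subtype _) =
      (insert a (insert a' (nbrs R (W.map (Function.Embedding.subtype _))))).erase a' := by
  ext x
  simp only [mem_map, mem_nbrs, Function.Embedding.coe_subtype, mem_erase, mem_insert] at hmem ⊢
  constructor
  · rintro ⟨x, ⟨y, hy, hxy | ⟨hx, hxy⟩⟩, rfl⟩
    · exact ⟨x.2, Or.inr (Or.inr ⟨y, ⟨y, hy, rfl⟩, hxy⟩)⟩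
    · exact ⟨x.2, Or.inl hx⟩
  · rintro ⟨hx, rfl | rfl | ⟨_, ⟨y, hy, rfl⟩, hxy⟩⟩
    · rcases hmem with ⟨_, ⟨y, hy, rfl⟩, hxy⟩ | ⟨_, ⟨y, hy, rfl⟩, hxy⟩
      · exact ⟨⟨_, hx⟩, ⟨y, hy, Or.inl hxy⟩, rfl⟩
      · exact ⟨⟨_, hx⟩, ⟨y, hy, Or.inr ⟨rfl, hxy⟩⟩, rfl⟩
    · exact (hx rfl).elim
    · exact ⟨⟨x, hx⟩, ⟨y, hy, Or.inl hxy⟩, rfl⟩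

lemma card_subtype_ne {γ : Type*} [Fintype γ] (c : γ) :
    Fintype.card {x : γ // x ≠ c} + 1 = Fintype.card γ := by
  have := Fintype.card_pos_iff.2 ⟨c⟩
  rw [Fintype.card_subtype_compl, Fintype.card_subtype_eq]
  omega

/-- The surplus of a set does not increase under merging. -/
lemma card_nbrs_merge_le (hne : a ≠ a') (hb : ∀ x, R x b ↔ x = a ∨ x = a') {W : Finset β}
    (hW : (nbrs R W).card ≤ W.card + 1) :
    (nbrs (mergeRel R a a' b) (W.subtype (· ≠ b))).card ≤ (W.subtype (· ≠ b)).card + 1 := by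
  have hV : (W.subtype (· ≠ b)).map (Function.Embedding.subtype _) = W.erase b := by
    ext y; simp [and_comm]
  have hVc : (W.subtype (· ≠ b)).card = (W.erase b).card := by rw [← hV, card_map]
  rw [hVc]
  have hN : (nbrs (mergeRel R a a' b) (W.subtype (· ≠ b))).card ≤
      (if b ∈ W then (nbrs R W).card - 1 else (nbrs R W).card) := by
    by_cases hmem : a ∈ nbrs R (W.erase b) ∨ a' ∈ nbrs R (W.erase b)
    · have hm := congrArg card (map_nbrs_merge_of_mem hne (W.subtype (· ≠ b)) (by rwa [hV]))
      rw [card_map, hV, card_erase_of_mem (by simp)] at hm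
      rw [hm]
      split_ifs with hbW
      · rw [← nbrs_insert_of_iff hb, insert_erase hbW]
      · rw [erase_eq_of_notMem hbW] at hmem ⊢
        rcases hmem with hmem | hmem
        · rw [insert_comm, insert_eq_of_mem hmem]
          have := card_insert_le a' (nbrs R W)
          omega
        · rw [insert_eq_of_mem hmem]
          have := card_insert_le a (nbrs R W)
          omega
    · rw [not_or] at hmem
      have hm := congrArg card (map_nbrs_merge_of_notMem (a := a) (W.subtype (· ≠ b))
        (by rw [hV]; exact hmem.2))
      rw [card_map, hV] at hm
      rw [hm]
      split_ifs with hbW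
      · have : nbrs R (W.erase b) ⊆ (nbrs R W).erase a := fun x hx =>
          mem_erase.2 ⟨fun hc => hmem.1 (hc ▸ hx), nbrs_mono (erase_subset _ _) hx⟩
        have h2 := card_le_card this
        rwa [card_erase_of_mem (mem_nbrs.2 ⟨b, hbW, (hb a).2 (Or.inl rfl)⟩)] at h2
      · rw [erase_eq_of_notMem hbW]
  split_ifs at hN with hbW
  · rw [card_erase_of_mem hbW]
    have := card_pos.2 ⟨b, hbW⟩
    omega
  · rw [erase_eq_of_notMem hbW]
    omega

lemma deg_flip_merge (hne : a ≠ a') {y : {y : β // y ≠ b}} (hy : ¬ (R a y ∧ R a' y)) :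
    deg (flip (mergeRel R a a' b)) y = deg (flip R) y.1 := by
  rw [← card_nbrs_singleton (mergeRel R a a' b), ← card_nbrs_singleton R]
  have hmap : ({y} : Finset {y : β // y ≠ b}).map (Function.Embedding.subtype _) = {y.1} := by simp
  have hiff : ∀ x, x ∈ nbrs R {y.1} ↔ R x y := by simp
  by_cases hmem : a ∈ nbrs R {y.1} ∨ a' ∈ nbrs R {y.1}
  · have hm := congrArg card (map_nbrs_merge_of_mem hne {y} (by rwa [hmap]))
    rw [card_map, hmap, card_erase_of_mem (by simp)] at hm
    rw [hm]
    rcases hmem with hmem | hmem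
    · have : a' ∉ nbrs R {y.1} := fun hc => hy ⟨(hiff a).1 hmem, (hiff a').1 hc⟩
      rw [insert_eq_of_mem (mem_insert_of_mem hmem), card_insert_of_notMem this]
      omega
    · have : a ∉ nbrs R {y.1} := fun hc => hy ⟨(hiff a).1 hc, (hiff a').1 hmem⟩
      rw [insert_eq_of_mem hmem, card_insert_of_notMem this]
      omega
  · rw [not_or] at hmem
    have hm := congrArg card (map_nbrs_merge_of_notMem (a := a) {y} (by rw [hmap]; exact hmem.2))
    rwa [card_map, hmap] at hm

variable [Fintype β]

lemma IsMC.merge (h : IsMC R) (hβ : 3 ≤ Fintype.card β) (hne : a ≠ a')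
    (hb : ∀ x, R x b ↔ x = a ∨ x = a') : IsMC (mergeRel R a a' b) where
  card_eq := by
    have := card_subtype_ne a'
    have := card_subtype_ne b
    have := h.card_eq
    omega
  two_le := by
    have := card_subtype_ne b
    omega
  surplus := by
    intro W hW hWu
    set V := W.map (Function.Embedding.subtype _) with hV
    have hVc : V.card = W.card := card_map _
    have hbV : b ∉ V := by simp [hV]
    by_cases hmem : a ∈ nbrs R V ∨ a' ∈ nbrs R V
    · have hm := congrArg card (map_nbrs_merge_of_mem hne W hmem)
      rw [card_map, ← hV, ← nbrs_insert_of_iff hb, card_erase_of_mem (by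
        rw [nbrs_insert_of_iff hb]; simp)] at hm
      have hs := h.surplus (insert b V) (insert_nonempty _ _) (fun hc => hWu (by
        ext y
        have hy : y.1 ∈ insert b V := hc ▸ mem_univ _
        have hy' := (mem_insert.1 hy).resolve_left y.2
        rw [hV, mem_map] at hy'
        obtain ⟨z, hz, hzy⟩ := hy'
        simpa [← Subtype.ext hzy] using hz))
      rw [card_insert_of_notMem hbV] at hs
      omega
    · rw [not_or] at hmem
      have hm := congrArg card (map_nbrs_merge_of_notMem (a := a) W hmem.2)
      rw [card_map] at hm
      rw [hm, ← hVc]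
      exact h.surplus V (hW.map) (fun hc => hbV (hc ▸ mem_univ _))

lemma IsMinMC.no_common (h : IsMinMC R) (hβ : 3 ≤ Fintype.card β) (hne : a ≠ a')
    (hb : ∀ x, R x b ↔ x = a ∨ x = a')
    (hd : (3 ≤ deg R a ∧ 3 ≤ deg R a') ∨ (deg R a = 2 ∧ deg R a' = 2)) {y : β} (hy : y ≠ b)
    (hay : R a y) (hay' : R a' y) : False := by
  have hab := (hb a).2 (Or.inl rfl)
  have hab' := (hb a').2 (Or.inr rfl)
  rcases hd with ⟨-, hd⟩ | ⟨hd, hd'⟩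
  · obtain ⟨W, hW⟩ := h.exists_maxTight hay
    obtain ⟨W', hW'⟩ := h.tight a' b hab'
    exact (h.tight_union hne hy hay hay' hab' hd hW.1 hW').1 (mem_nbrs.2 ⟨b, hW'.1, hab⟩)
  · have hc : ({b, y} : Finset β)ᶜ.card = Fintype.card β - 2 := by
      rw [card_compl, card_pair hy.symm]
    have hs := h.surplus ({b, y} : Finset β)ᶜ (by rw [← card_pos]; omega) (by
      intro hu
      have := mem_univ b
      rw [← hu] at this
      simp at this)
    have hsub : nbrs R ({b, y} : Finset β)ᶜ ⊆ ({a, a'} : Finset α)ᶜ := by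
      intro x hx
      obtain ⟨z, hz, hxz⟩ := mem_nbrs.1 hx
      simp only [mem_compl, mem_insert, mem_singleton] at hz ⊢
      rintro (rfl | rfl)
      · exact hz (eq_or_eq_of_deg_eq_two hd hy.symm hab hay hxz)
      · exact hz (eq_or_eq_of_deg_eq_two hd' hy.symm hab' hay' hxz)
    have := card_le_card hsub
    rw [card_compl, card_pair hne] at this
    have := h.card_eq
    omega

lemma IsMinMC.merge (h : IsMinMC R) (hβ : 3 ≤ Fintype.card β) (hne : a ≠ a')
    (hb : ∀ x, R x b ↔ x = a ∨ x = a')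
    (hd : (3 ≤ deg R a ∧ 3 ≤ deg R a') ∨ (deg R a = 2 ∧ deg R a' = 2)) :
    IsMinMC (mergeRel R a a' b) where
  toIsMC := h.toIsMC.merge hβ hne hb
  tight := by
    have hM := h.toIsMC.merge hβ hne hb
    have merged : ∀ p q : α, (p = a ∧ q = a' ∨ p = a' ∧ q = a) → ∀ y : {y : β // y ≠ b},
        R p y → ∀ x : {x : α // x ≠ a'}, x.1 = a → ∃ W, IsTight (mergeRel R a a' b) x y W := by
      intro p q hpq y hpy x hx
      have hpb : R p b := (hb p).2 (by tauto)
      have hqb : R q b := (hb q).2 (by tauto)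
      have hor : ∀ z : {y : β // y ≠ b}, mergeRel R a a' b x z → R p z ∨ R q z := by
        rintro z (hz | ⟨-, hz⟩)
        · rw [hx] at hz
          rcases hpq with ⟨rfl, rfl⟩ | ⟨rfl, rfl⟩ <;> tauto
        · rcases hpq with ⟨rfl, rfl⟩ | ⟨rfl, rfl⟩ <;> tauto
      have hcases : 3 ≤ deg R p ∨ (deg R p = 2 ∧ deg R q = 2) := by
        rcases hpq with ⟨rfl, rfl⟩ | ⟨rfl, rfl⟩ <;> tauto
      rcases hcases with hd3 | ⟨hp2, hq2⟩
      · obtain ⟨W, hW⟩ := h.tight p y hpy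
        have hbW : b ∉ W := fun hc => y.2 (hW.2.1 b hc hpb).symm
        have hqW : q ∉ nbrs R W := by
          intro hc
          have hpW : p ∈ nbrs R W := mem_nbrs.2 ⟨y, hW.1, hpy⟩
          have hins : nbrs R (insert b W) = nbrs R W := by
            rw [nbrs_insert_of_iff hb]
            rcases hpq with ⟨rfl, rfl⟩ | ⟨rfl, rfl⟩ <;>
              rw [insert_eq_of_mem (by simp [*] : _ ∈ insert _ (nbrs R W)), insert_eq_of_mem ‹_›]
          have hu : insert b W = univ := by
            by_contra hu
            have hs := h.surplus _ (insert_nonempty b W) hu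
            rw [hins, card_insert_of_notMem hbW] at hs
            have := hW.2.2
            omega
          have hsub : (univ.filter fun z => R p z) ⊆ {b, y.1} := by
            intro z hz
            have hz' : R p z := by simpa using hz
            have hzu : z ∈ insert b W := hu ▸ mem_univ z
            rcases mem_insert.1 hzu with rfl | hzW
            · simp
            · simp [hW.2.1 z hzW hz']
          have := (card_le_card hsub).trans card_le_two
          unfold deg at hd3
          omega
        refine ⟨W.subtype (· ≠ b), by simpa using hW.1, ?_, card_nbrs_merge_le hne hb hW.2.2⟩
        intro z hz hxz
        have hzW : z.1 ∈ W := by simpa using hz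
        rcases hor z hxz with hz' | hz'
        · exact Subtype.ext (hW.2.1 z hzW hz')
        · exact (hqW (mem_nbrs.2 ⟨z, hzW, hz'⟩)).elim
      · obtain ⟨w, hwb, hqw⟩ := h.exists_ne q b
        have hyw : y.1 ≠ w := by
          intro hc
          rcases hpq with ⟨rfl, rfl⟩ | ⟨rfl, rfl⟩
          · exact h.no_common hβ hne hb hd y.2 hpy (hc ▸ hqw)
          · exact h.no_common hβ hne hb hd y.2 (hc ▸ hqw) hpy
        refine ⟨univ.erase ⟨w, hwb⟩, mem_erase.2 ⟨fun hc => hyw (congrArg Subtype.val hc),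
          mem_univ _⟩, ?_, ?_⟩
        · intro z hz hxz
          have hzw : z.1 ≠ w := fun hc => (mem_erase.1 hz).1 (Subtype.ext hc)
          rcases hor z hxz with hz' | hz'
          · exact Subtype.ext ((eq_or_eq_of_deg_eq_two hp2 y.2.symm hpb hpy hz').resolve_left z.2)
          · exact (hzw ((eq_or_eq_of_deg_eq_two hq2 hwb.symm hqb hqw hz').resolve_left z.2)).elim
        · rw [card_erase_add_one (mem_univ _), card_univ, ← hM.card_eq]
          exact card_le_univ _
    intro x y hxy
    by_cases hx : x.1 = a
    · rcases hxy with hxy | ⟨-, hxy⟩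
      · exact merged a a' (Or.inl ⟨rfl, rfl⟩) y (hx ▸ hxy) x hx
      · exact merged a' a (Or.inr ⟨rfl, rfl⟩) y hxy x hx
    · have hiff : ∀ z : {y : β // y ≠ b}, mergeRel R a a' b x z ↔ R x z := fun z =>
        ⟨fun hz => hz.resolve_right fun hc => hx hc.1, Or.inl⟩
      obtain ⟨W, hW⟩ := h.tight x y ((hiff y).1 hxy)
      refine ⟨W.subtype (· ≠ b), by simpa using hW.1, ?_, card_nbrs_merge_le hne hb hW.2.2⟩
      intro z hz hxz
      exact Subtype.ext (hW.2.1 z (by simpa using hz) ((hiff z).1 hxz))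

/-- If both neighbours of a vertex of degree two have degree at least three, or both have degree
two, then the bound of `IsMinMC.edgeCount_le` for its colour class is strict. -/
theorem IsMinMC.edgeCount_lt (h : IsMinMC R) (hβ : 3 ≤ Fintype.card β) (hne : a ≠ a')
    (hb : ∀ x, R x b ↔ x = a ∨ x = a')
    (hd : (3 ≤ deg R a ∧ 3 ≤ deg R a') ∨ (deg R a = 2 ∧ deg R a' = 2)) :
    edgeCount R + 2 < (twos (flip R)).card + (Fintype.card α + Fintype.card β) := by
  have hdeg : ∀ y : {y : β // y ≠ b}, deg (flip (mergeRel R a a' b)) y = deg (flip R) y.1 :=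
    fun y => deg_flip_merge hne fun hc => h.no_common hβ hne hb hd y.2 hc.1 hc.2
  have hb2 : deg (flip R) b = 2 := by
    rw [← card_pair hne]
    unfold deg
    congr 1
    ext x
    rw [mem_filter]
    simpa [flip] using hb x
  have hbound := (h.merge hβ hne hb hd).swap.edgeCount_le
  have htwos : (twos (flip (mergeRel R a a' b))).map (Function.Embedding.subtype _) =
      (twos (flip R)).erase b := by
    ext y
    simp [twos, hdeg, and_comm]
  have htc := congrArg card htwos
  have hbt : b ∈ twos (flip R) := by simp [twos, hb2]
  rw [card_map, card_erase_of_mem hbt] at htc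
  have hpos := card_pos.2 ⟨b, hbt⟩
  have hedge : edgeCount (flip (mergeRel R a a' b)) + 2 = edgeCount R := by
    rw [← edgeCount_flip R]
    unfold edgeCount
    rw [sum_congr rfl fun y _ => hdeg y, ← add_sum_erase univ (deg (flip R)) (mem_univ b), hb2,
      add_comm]
    congr 1
    rw [sum_subtype (univ.erase b) (p := (· ≠ b)) (by simp)]
  have := card_subtype_ne a'
  have := card_subtype_ne b
  omega

/-- In an extremal relation, every right vertex of degree two has a unique neighbour of degree
two. -/
theorem IsMinMC.existsUnique_of_extremal (h : IsMinMC R) (hβ : 3 ≤ Fintype.card β)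
    (hext : (twos (flip R)).card + (Fintype.card α + Fintype.card β) = edgeCount R + 2) {b : β}
    (hb : deg (flip R) b = 2) : ∃! a, R a b ∧ deg R a = 2 := by
  obtain ⟨a, a', hne, hs⟩ := card_eq_two.1 hb
  have hiff : ∀ x, R x b ↔ x = a ∨ x = a' := fun x => by
    have := Finset.ext_iff.1 hs x
    rw [mem_filter] at this
    simpa [flip] using this
  have hnot : ¬ ((3 ≤ deg R a ∧ 3 ≤ deg R a') ∨ (deg R a = 2 ∧ deg R a' = 2)) := fun hd => by
    have := h.edgeCount_lt hβ hne hiff hd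
    omega
  have h1 := h.two_le_deg a
  have h2 := h.two_le_deg a'
  rcases (by omega : (deg R a = 2 ∧ deg R a' ≠ 2) ∨ (deg R a' = 2 ∧ deg R a ≠ 2)) with
    ⟨ha, ha'⟩ | ⟨ha', ha⟩
  · refine ⟨a, ⟨(hiff a).2 (Or.inl rfl), ha⟩, fun x hx => ?_⟩
    rcases (hiff x).1 hx.1 with rfl | rfl
    · rfl
    · exact (ha' hx.2).elim
  · refine ⟨a', ⟨(hiff a').2 (Or.inr rfl), ha'⟩, fun x hx => ?_⟩
    rcases (hiff x).1 hx.1 with rfl | rfl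
    · exact (ha hx.2).elim
    · rfl

end Merge

end BipRel

/-! ### From graphs to relations -/

section Graph

open scoped Classical

variable {V : Type*} {G : SimpleGraph V} {p : V → Prop}

/-- The adjacency relation between the two colour classes given by `p`. -/
def biRel (G : SimpleGraph V) (p : V → Prop) (a : {v : V // p v}) (b : {v : V // ¬ p v}) : Prop :=
  G.Adj a b

namespace BipRel

open Finset

lemma exists_equiv_of_isPerfectMatching (hp : ∀ u v, G.Adj u v → (p u ↔ ¬ p v))
    {M : G.Subgraph} (hM : M.IsPerfectMatching) :
    ∃ f : {v : V // ¬ p v} ≃ {v : V // p v}, (∀ b, G.Adj (f b) b) ∧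
      ∀ a b, M.Adj a.1 b.1 → f b = a := by
  choose m hm using Subgraph.isPerfectMatching_iff.1 hM
  have hadj : ∀ v, G.Adj v (m v) := fun v => M.adj_sub (hm v).1
  have hinv : ∀ v, m (m v) = v := fun v => ((hm (m v)).2 v (hm v).1.symm).symm
  refine ⟨⟨fun b => ⟨m b, ?_⟩, fun a => ⟨m a, ?_⟩, fun b => ?_, fun a => ?_⟩, ?_, ?_⟩
  · have := hp _ _ (hadj b)
    have := b.2
    tauto
  · have := hp _ _ (hadj a)
    have := a.2
    tauto
  · exact Subtype.ext (hinv b)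
  · exact Subtype.ext (hinv a)
  · exact fun b => (hadj b).symm
  · exact fun a b hab => Subtype.ext ((hm b).2 a hab.symm).symm

/-- The spanning subgraph of a bijection between the colour classes. -/
def subgraphOfEquiv (f : {v : V // ¬ p v} ≃ {v : V // p v}) (hf : ∀ b, G.Adj (f b) b) :
    G.Subgraph where
  verts := Set.univ
  Adj u v := ∃ b, (u = b.1 ∧ v = (f b).1) ∨ (v = b.1 ∧ u = (f b).1)
  adj_sub := by
    rintro u v ⟨b, ⟨rfl, rfl⟩ | ⟨rfl, rfl⟩⟩
    · exact (hf b).symm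
    · exact hf b
  edge_vert _ := Set.mem_univ _
  symm := ⟨fun _ _ ⟨b, hb⟩ => ⟨b, hb.symm⟩⟩

lemma subgraphOfEquiv_isPerfectMatching (f : {v : V // ¬ p v} ≃ {v : V // p v})
    (hf : ∀ b, G.Adj (f b) b) : (subgraphOfEquiv f hf).IsPerfectMatching := by
  rw [Subgraph.isPerfectMatching_iff]
  intro v
  by_cases hv : p v
  · refine ⟨(f.symm ⟨v, hv⟩).1, ⟨f.symm ⟨v, hv⟩, Or.inr ⟨rfl, by simp⟩⟩, ?_⟩
    rintro w ⟨b, ⟨rfl, rfl⟩ | ⟨rfl, rfl⟩⟩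
    · exact (b.2 hv).elim
    · simp
  · refine ⟨(f ⟨v, hv⟩).1, ⟨⟨v, hv⟩, Or.inl ⟨rfl, rfl⟩⟩, ?_⟩
    rintro w ⟨b, ⟨rfl, rfl⟩ | ⟨rfl, rfl⟩⟩
    · rfl
    · exact (hv (f b).2).elim

lemma ncard_twoEdge (hp : ∀ u v, G.Adj u v → (p u ↔ ¬ p v))
    (hu : ∀ v, degN G v = 2 → ∃! w, G.Adj v w ∧ degN G w = 2) :
    {e | IsTwoEdge G e}.ncard = {v | p v ∧ degN G v = 2}.ncard := by
  choose f hf hfu using hu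
  symm
  refine Set.ncard_congr (fun v hv => s(v, f v hv.2)) ?_ ?_ ?_
  · intro v hv
    refine ⟨(hf v hv.2).1, fun w hw => ?_⟩
    rcases Sym2.mem_iff.1 hw with rfl | rfl
    · exact hv.2
    · exact (hf v hv.2).2
  · intro v w hv hw hvw
    rcases Sym2.eq_iff.1 hvw with ⟨h, -⟩ | ⟨h, -⟩
    · exact h
    · have h1 := (hp _ _ (hf w hw.2).1).1 hw.1
      exact (h1 (h ▸ hv.1)).elim
  · have key : ∀ u v, p u → G.Adj u v → degN G u = 2 → degN G v = 2 →
        ∃ a, ∃ ha : a ∈ {v | p v ∧ degN G v = 2}, s(a, f a ha.2) = s(u, v) := by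
      intro u v hpu huv hu2 hv2
      exact ⟨u, ⟨hpu, hu2⟩, by rw [hfu u hu2 v ⟨huv, hv2⟩]⟩
    intro e
    induction e with
    | _ u v =>
      rintro ⟨huv, h2⟩
      have hu2 := h2 u (Sym2.mem_mk_left u v)
      have hv2 := h2 v (Sym2.mem_mk_right u v)
      by_cases hu : p u
      · exact key u v hu huv hu2 hv2
      · have hv : p v := by
          have := hp u v huv
          tauto
        rw [Sym2.eq_swap]
        exact key v u hv huv.symm hv2 hu2

variable [Fintype V]

lemma card_subtype_add_card_subtype_not (p : V → Prop) :
    Fintype.card {v : V // p v} + Fintype.card {v : V // ¬ p v} = Fintype.card V := by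
  rw [← Fintype.card_sum]
  exact Fintype.card_congr (Equiv.sumCompl p)

lemma isMC_of_matchingCovered (hp : ∀ u v, G.Adj u v → (p u ↔ ¬ p v)) (h : MatchingCovered G) :
    IsMC (biRel G p) := by
  obtain ⟨hconn, hcard, hpm⟩ := h
  have hcardeq : Fintype.card {v : V // p v} = Fintype.card {v : V // ¬ p v} := by
    have : Nontrivial V := Fintype.one_lt_card_iff_nontrivial.1 (by omega)
    obtain ⟨v⟩ := hconn.nonempty
    obtain ⟨w, hw⟩ := hconn.preconnected.exists_adj_of_nontrivial v
    obtain ⟨M, hM, -⟩ := hpm s(v, w) hw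
    obtain ⟨f, -⟩ := exists_equiv_of_isPerfectMatching hp hM
    exact (Fintype.card_congr f).symm
  have hsum := card_subtype_add_card_subtype_not p
  refine ⟨hcardeq, by omega, fun W ⟨w, hw⟩ hWu => ?_⟩
  obtain ⟨a, ha, y, hy, hay⟩ : ∃ a ∈ nbrs (biRel G p) W, ∃ y ∉ W, biRel G p a y := by
    by_contra! hcl
    obtain ⟨y, hy⟩ : ∃ y, y ∉ W := by
      by_contra! hc
      exact hWu (eq_univ_iff_forall.2 hc)
    have key : ∀ u v, G.Walk u v → ((∃ b ∈ W, b.1 = u) ∨ ∃ b ∈ W, G.Adj u b.1) →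
        ((∃ b ∈ W, b.1 = v) ∨ ∃ b ∈ W, G.Adj v b.1) := by
      intro u v q
      induction q with
      | nil => exact id
      | cons hadj q ih =>
        rename_i u₁ u₂ u₃
        intro hu
        refine ih ?_
        rcases hu with ⟨b, hb, rfl⟩ | ⟨b, hb, hub⟩
        · exact Or.inr ⟨b, hb, hadj.symm⟩
        · have h1 := hp _ _ hub
          have h2 := hp _ _ hadj
          have h3 := b.2
          have h4 := hcl ⟨u₁, by tauto⟩ (mem_nbrs.2 ⟨b, hb, hub⟩) ⟨u₂, by tauto⟩
          by_contra hc
          rw [not_or] at hc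
          exact h4 (fun hc' => hc.1 ⟨_, hc', rfl⟩) hadj
    obtain ⟨q⟩ := hconn.preconnected w.1 y.1
    rcases key _ _ q (Or.inl ⟨w, hw, rfl⟩) with ⟨b, hb, hby⟩ | ⟨b, hb, hby⟩
    · exact hy (Subtype.ext hby ▸ hb)
    · have h1 := hp _ _ hby
      have h2 := b.2
      have h3 := y.2
      tauto
  obtain ⟨M, hM, hMe⟩ := hpm s(a.1, y.1) hay
  obtain ⟨f, hf, hfM⟩ := exists_equiv_of_isPerfectMatching hp hM
  have hfy := hfM a y hMe
  have hsub : W.map f.toEmbedding ⊆ (nbrs (biRel G p) W).erase a := by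
    intro x hx
    obtain ⟨b, hb, rfl⟩ := mem_map.1 hx
    refine mem_erase.2 ⟨fun hc => hy ?_, mem_nbrs.2 ⟨b, hb, hf b⟩⟩
    have : b = y := f.injective (hc.trans hfy.symm)
    exact this ▸ hb
  have h1 := card_le_card hsub
  rw [card_map, card_erase_of_mem ha] at h1
  have := card_pos.2 ⟨a, ha⟩
  omega

lemma connected_of_isMC (h : IsMC (biRel G p)) : G.Connected := by
  have h2 := h.two_le
  obtain ⟨b₀⟩ : Nonempty {v : V // ¬ p v} := Fintype.card_pos_iff.1 (by omega)
  have hW : (univ.filter fun b : {v : V // ¬ p v} => G.Reachable b₀ b) = univ := by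
    by_contra hne
    set W := univ.filter fun b : {v : V // ¬ p v} => G.Reachable b₀ b with hWdef
    have hb₀ : b₀ ∈ W := by simp [hWdef]
    have h1 := h.surplus W ⟨b₀, hb₀⟩ hne
    have h3 := h.surplus Wᶜ (nonempty_iff_ne_empty.2 fun hc => hne ((compl_eq_empty_iff _).1 hc))
      (fun hc => by
        have := mem_univ b₀
        rw [← hc, mem_compl] at this
        exact this hb₀)
    have hdis : Disjoint (nbrs (biRel G p) W) (nbrs (biRel G p) Wᶜ) := by
      rw [Finset.disjoint_left]
      intro a ha ha'
      obtain ⟨b, hb, hab⟩ := mem_nbrs.1 ha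
      obtain ⟨b', hb', hab'⟩ := mem_nbrs.1 ha'
      have hr : G.Reachable b₀ b := by simpa [hWdef] using hb
      have hr' : ¬ G.Reachable b₀ b' := by simpa [hWdef] using hb'
      have e1 : G.Adj a.1 b.1 := hab
      have e2 : G.Adj a.1 b'.1 := hab'
      exact hr' ((hr.trans e1.symm.reachable).trans e2.reachable)
    have h4 := card_le_univ (nbrs (biRel G p) W ∪ nbrs (biRel G p) Wᶜ)
    rw [card_union_of_disjoint hdis] at h4
    have h5 := Finset.card_add_card_compl W
    have := h.card_eq
    omega
  have hreach : ∀ v, G.Reachable b₀ v := by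
    intro v
    have hβ : ∀ b : {v : V // ¬ p v}, G.Reachable b₀ b := fun b => by
      have := mem_univ b
      rw [← hW] at this
      simpa using this
    by_cases hv : p v
    · obtain ⟨b, -, hvb⟩ := h.exists_ne ⟨v, hv⟩ b₀
      have e1 : G.Adj v b.1 := hvb
      exact (hβ b).trans e1.symm.reachable
    · exact hβ ⟨v, hv⟩
  have : Nonempty V := ⟨b₀⟩
  exact ⟨fun u v => (hreach u).symm.trans (hreach v)⟩

/-- Every edge of a relation with surplus extends to a perfect matching. -/
lemma IsMC.exists_equiv {α β : Type*} [Fintype α] [Fintype β] {R : α → β → Prop} (h : IsMC R)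
    {a : α} {b : β} (hab : R a b) : ∃ f : β ≃ α, (∀ y, R (f y) y) ∧ f b = a := by
  obtain ⟨g, hg, hgt⟩ := (all_card_le_biUnion_card_iff_exists_injective
    (fun y : {y : β // y ≠ b} => univ.filter fun x => R x y ∧ x ≠ a)).1 (by
      intro s
      rcases s.eq_empty_or_nonempty with rfl | hs
      · simp
      have hs' := h.surplus (s.map (Function.Embedding.subtype _)) (hs.map) (fun hc => by
        have := mem_univ b
        rw [← hc] at this
        simp at this)
      rw [card_map] at hs'
      have hsub : (nbrs R (s.map (Function.Embedding.subtype _))).erase a ⊆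
          s.biUnion fun y => univ.filter fun x => R x y ∧ x ≠ a := by
        intro x hx
        obtain ⟨hxa, hx⟩ := mem_erase.1 hx
        obtain ⟨y, hy, hxy⟩ := mem_nbrs.1 hx
        obtain ⟨z, hz, rfl⟩ := mem_map.1 hy
        exact mem_biUnion.2 ⟨z, hz, mem_filter.2 ⟨mem_univ _, hxy, hxa⟩⟩
      have h1 := card_le_card hsub
      have h2 := pred_card_le_card_erase (s := nbrs R (s.map (Function.Embedding.subtype _)))
        (a := a)
      omega)
  have hgt' : ∀ y, R (g y) y ∧ g y ≠ a := fun y => (mem_filter.1 (hgt y)).2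
  let f : β → α := fun y => if hy : y = b then a else g ⟨y, hy⟩
  have hfb : f b = a := dif_pos rfl
  have hfn : ∀ y (hy : y ≠ b), f y = g ⟨y, hy⟩ := fun y hy => dif_neg hy
  have hinj : Function.Injective f := by
    intro y z hyz
    by_cases hy : y = b <;> by_cases hz : z = b
    · rw [hy, hz]
    · subst hy
      rw [hfb, hfn z hz] at hyz
      exact ((hgt' _).2 hyz.symm).elim
    · subst hz
      rw [hfb, hfn y hy] at hyz
      exact ((hgt' _).2 hyz).elim
    · rw [hfn y hy, hfn z hz] at hyz
      exact congrArg Subtype.val (hg hyz)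
  refine ⟨Equiv.ofBijective f ((Fintype.bijective_iff_injective_and_card f).2
    ⟨hinj, h.card_eq.symm⟩), fun y => ?_, hfb⟩
  rw [Equiv.ofBijective_apply]
  by_cases hy : y = b
  · subst hy
    rwa [hfb]
  · rw [hfn y hy]
    exact (hgt' ⟨y, hy⟩).1

lemma matchingCovered_of_isMC (hp : ∀ u v, G.Adj u v → (p u ↔ ¬ p v)) (h : IsMC (biRel G p)) :
    MatchingCovered G := by
  refine ⟨connected_of_isMC h, ?_, ?_⟩
  · have := h.two_le
    have := h.card_eq
    have := BipRel.card_subtype_add_card_subtype_not p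
    omega
  · have key : ∀ u v, p u → G.Adj u v →
        ∃ M : G.Subgraph, M.IsPerfectMatching ∧ M.Adj u v := by
      intro u v hu huv
      obtain ⟨f, hf, hfb⟩ := h.exists_equiv (a := ⟨u, hu⟩) (b := ⟨v, (hp u v huv).1 hu⟩) huv
      exact ⟨subgraphOfEquiv f hf, subgraphOfEquiv_isPerfectMatching f hf,
        ⟨⟨v, (hp u v huv).1 hu⟩, Or.inr ⟨rfl, by rw [hfb]⟩⟩⟩
    intro e
    induction e with
    | _ u v =>
      intro huv
      by_cases hu : p u
      · exact key u v hu huv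
      · have hv : p v := by
          have := hp u v huv
          tauto
        obtain ⟨M, hM, hadj⟩ := key v u hv huv.symm
        exact ⟨M, hM, hadj.symm⟩

lemma IsMC.exists_tight {α β : Type*} [Fintype α] [Fintype β] {R R' : α → β → Prop}
    (h : IsMC R) {a : α} {b : β} (hR' : ∀ x y, R' x y ↔ R x y ∧ ¬ (x = a ∧ y = b))
    (hn : ¬ IsMC R') : ∃ W, IsTight R a b W := by
  obtain ⟨W, hW, hWu, hle⟩ : ∃ W : Finset β, W.Nonempty ∧ W ≠ univ ∧
      (nbrs R' W).card ≤ W.card := by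
    by_contra! hc
    exact hn ⟨h.card_eq, h.two_le, hc⟩
  have hs := h.surplus W hW hWu
  have hsub : nbrs R W ⊆ insert a (nbrs R' W) := by
    intro x hx
    obtain ⟨y, hy, hxy⟩ := mem_nbrs.1 hx
    by_cases hxa : x = a
    · exact mem_insert.2 (Or.inl hxa)
    · exact mem_insert_of_mem (mem_nbrs.2 ⟨y, hy, (hR' x y).2 ⟨hxy, fun hc => hxa hc.1⟩⟩)
  have hna : ∀ y ∈ W, ¬ R' a y := by
    intro y hy hay
    rw [insert_eq_of_mem (mem_nbrs.2 ⟨y, hy, hay⟩)] at hsub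
    have := card_le_card hsub
    omega
  have huniq : ∀ y ∈ W, R a y → y = b := by
    intro y hy hay
    by_contra hyb
    exact hna y hy ((hR' a y).2 ⟨hay, fun hc => hyb hc.2⟩)
  refine ⟨W, ?_, huniq, ?_⟩
  · by_contra hb
    have : nbrs R W ⊆ nbrs R' W := by
      intro x hx
      obtain ⟨y, hy, hxy⟩ := mem_nbrs.1 hx
      exact mem_nbrs.2 ⟨y, hy, (hR' x y).2 ⟨hxy, fun hc => hb (hc.2 ▸ hy)⟩⟩
    have := card_le_card this
    omega
  · have h1 := card_le_card hsub
    have h2 := card_insert_le a (nbrs R' W)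
    omega

lemma isMinMC_of_minimalMatchingCovered (hp : ∀ u v, G.Adj u v → (p u ↔ ¬ p v))
    (h : MinimalMatchingCovered G) : IsMinMC (biRel G p) where
  toIsMC := isMC_of_matchingCovered hp h.1
  tight := by
    intro a b hab
    have hn := h.2 s(a.1, b.1) hab
    refine (isMC_of_matchingCovered hp h.1).exists_tight
      (R' := biRel (G.deleteEdges {s(a.1, b.1)}) p) ?_
      (fun hc => hn (matchingCovered_of_isMC (fun u v huv => hp u v ?_) hc))
    · intro x y
      have hxb : x.1 ≠ b.1 := fun hc => b.2 (hc ▸ x.2)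
      simp [biRel, deleteEdges_adj, Subtype.ext_iff, hxb]
    · exact (deleteEdges_adj.1 huv).1

lemma deg_biRel (hp : ∀ u v, G.Adj u v → (p u ↔ ¬ p v)) (a : {v : V // p v}) :
    deg (biRel G p) a = degN G a := by
  rw [deg, degN, ← card_map (Function.Embedding.subtype _), ← Set.ncard_coe_finset]
  congr 1
  ext v
  simp only [coe_map, Function.Embedding.coe_subtype, Set.mem_image, mem_coe, mem_filter,
    mem_univ, true_and, mem_neighborSet]
  constructor
  · rintro ⟨y, hy, rfl⟩
    exact hy
  · exact fun hav => ⟨⟨v, (hp _ _ hav).1 a.2⟩, hav, rfl⟩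

lemma deg_flip_biRel (hp : ∀ u v, G.Adj u v → (p u ↔ ¬ p v)) (b : {v : V // ¬ p v}) :
    deg (flip (biRel G p)) b = degN G b := by
  rw [deg, degN, ← card_map (Function.Embedding.subtype _), ← Set.ncard_coe_finset]
  congr 1
  ext v
  simp only [coe_map, Function.Embedding.coe_subtype, Set.mem_image, mem_coe, mem_filter,
    mem_univ, true_and, mem_neighborSet]
  constructor
  · rintro ⟨y, hy, rfl⟩
    exact hy.symm
  · exact fun hbv => ⟨⟨v, (hp _ _ hbv.symm).2 b.2⟩, hbv.symm, rfl⟩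

lemma edgeCount_biRel (hp : ∀ u v, G.Adj u v → (p u ↔ ¬ p v)) :
    edgeCount (biRel G p) = G.edgeSet.ncard := by
  have hdeg : ∀ v, degN G v = G.degree v := fun v => by
    rw [degN, Set.ncard_eq_toFinset_card', ← card_neighborFinset_eq_degree]
    rfl
  have h1 := G.sum_degrees_eq_twice_card_edges
  have h2 : ∑ v, G.degree v = edgeCount (biRel G p) + edgeCount (flip (biRel G p)) := by
    rw [← Fintype.sum_subtype_add_sum_subtype p]
    unfold edgeCount
    congr 1
    · exact sum_congr rfl fun a _ => by rw [deg_biRel hp, hdeg]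
    · exact sum_congr rfl fun b _ => by rw [deg_flip_biRel hp, hdeg]
  rw [edgeCount_flip] at h2
  have h3 : G.edgeSet.ncard = #G.edgeFinset := by
    rw [← coe_edgeFinset, Set.ncard_coe_finset]
  omega

lemma card_twos_biRel (hp : ∀ u v, G.Adj u v → (p u ↔ ¬ p v)) :
    (twos (biRel G p)).card = {v | p v ∧ degN G v = 2}.ncard := by
  rw [← card_map (Function.Embedding.subtype _), ← Set.ncard_coe_finset]
  congr 1
  ext v
  simp [twos, deg_biRel hp, and_comm]

lemma card_twos_flip_biRel (hp : ∀ u v, G.Adj u v → (p u ↔ ¬ p v)) :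
    (twos (flip (biRel G p))).card = {v | ¬ p v ∧ degN G v = 2}.ncard := by
  rw [← card_map (Function.Embedding.subtype _), ← Set.ncard_coe_finset]
  congr 1
  ext v
  simp [twos, deg_flip_biRel hp, and_comm]

lemma ncard_degN_eq_two (hp : ∀ u v, G.Adj u v → (p u ↔ ¬ p v)) :
    {v | degN G v = 2}.ncard = (twos (biRel G p)).card + (twos (flip (biRel G p))).card := by
  rw [card_twos_biRel hp, card_twos_flip_biRel hp, ← Set.ncard_union_eq]
  · congr 1
    ext v
    simp only [Set.mem_ofPred_eq, Set.mem_union]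
    tauto
  · rw [Set.disjoint_left]
    exact fun v hv hv' => hv'.1 hv.1

lemma nonempty_iso_cycleGraph (hp : ∀ u v, G.Adj u v → (p u ↔ ¬ p v)) (h : IsMC (biRel G p))
    (hβ : Fintype.card {v : V // ¬ p v} = 2) : Nonempty (G ≃g cycleGraph 4) := by
  have hcomp : ∀ a b, biRel G p a b := by
    intro a b
    have := h.two_le_deg a
    have heq := eq_of_subset_of_card_le (subset_univ (univ.filter fun y => biRel G p a y))
      (by rw [card_univ, hβ]; exact this)
    have hb := mem_univ b
    rw [← heq] at hb
    exact (mem_filter.1 hb).2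
  have hadj : ∀ u v, G.Adj u v ↔ (p u ↔ ¬ p v) := by
    refine fun u v => ⟨hp u v, fun huv => ?_⟩
    by_cases hu : p u
    · exact hcomp ⟨u, hu⟩ ⟨v, huv.1 hu⟩
    · exact (hcomp ⟨v, by tauto⟩ ⟨u, hu⟩).symm
  have hq : ∀ x y : Fin 4, (cycleGraph 4).Adj x y ↔ (x.1 % 2 = 0 ↔ ¬ y.1 % 2 = 0) := by decide
  obtain ⟨e₁⟩ : Nonempty ({v : V // p v} ≃ {x : Fin 4 // x.1 % 2 = 0}) := by
    rw [← Fintype.card_eq, h.card_eq, hβ]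
    rfl
  obtain ⟨e₂⟩ : Nonempty ({v : V // ¬ p v} ≃ {x : Fin 4 // ¬ x.1 % 2 = 0}) := by
    rw [← Fintype.card_eq, hβ]
    rfl
  let e : V ≃ Fin 4 := ((Equiv.sumCompl p).symm.trans (Equiv.sumCongr e₁ e₂)).trans
    (Equiv.sumCompl fun x : Fin 4 => x.1 % 2 = 0)
  have he : ∀ v, (e v).1 % 2 = 0 ↔ p v := by
    intro v
    by_cases hv : p v
    · have : e v = (e₁ ⟨v, hv⟩).1 := by simp [e, hv]
      rw [this]
      exact iff_of_true (e₁ ⟨v, hv⟩).2 hv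
    · have : e v = (e₂ ⟨v, hv⟩).1 := by simp [e, hv]
      rw [this]
      exact iff_of_false (e₂ ⟨v, hv⟩).2 hv
  refine ⟨⟨e, fun {u v} => ?_⟩⟩
  rw [hq, he, he, hadj]

end BipRel

end Graph

/-- In a 2-vertex extremal minimal bipartite matching covered graph other than the 4-cycle,
every degree-2 vertex has exactly one neighbour of degree 2, and `|E₂| = m - n + 2`. -/
theorem stmt13 {V : Type*} [Fintype V] (G : SimpleGraph V)
    (hbip : G.Colorable 2) (hmin : MinimalMatchingCovered G)
    (hC4 : IsEmpty (G ≃g cycleGraph 4))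
    (hext : {v | degN G v = 2}.ncard + 2 * Fintype.card V = 2 * G.edgeSet.ncard + 4) :
    (∀ v, degN G v = 2 → ∃! w, G.Adj v w ∧ degN G w = 2) ∧
      {e | IsTwoEdge G e}.ncard + Fintype.card V = G.edgeSet.ncard + 2 := by
  classical
  obtain ⟨C⟩ := hbip
  obtain ⟨p, hp⟩ : ∃ p : V → Prop, ∀ u v, G.Adj u v → (p u ↔ ¬ p v) := by
    refine ⟨fun v => C v = 0, fun u v huv => ?_⟩
    have := C.valid huv
    omega
  have h := BipRel.isMinMC_of_minimalMatchingCovered hp hmin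
  have hV := BipRel.card_subtype_add_card_subtype_not p
  have hE := BipRel.edgeCount_biRel hp
  have hEf := BipRel.edgeCount_flip (biRel G p)
  have h1 := h.edgeCount_le
  have h2 := h.swap.edgeCount_le
  rw [BipRel.ncard_degN_eq_two hp] at hext
  have hβ : 3 ≤ Fintype.card {v : V // ¬ p v} := by
    by_contra hc
    have := h.two_le
    exact hC4.false (BipRel.nonempty_iso_cycleGraph hp h.toIsMC (by omega)).some
  have hu : ∀ v, degN G v = 2 → ∃! w, G.Adj v w ∧ degN G w = 2 := by
    intro v hv
    by_cases hpv : p v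
    · obtain ⟨w, hw, hwu⟩ := h.swap.existsUnique_of_extremal (h.card_eq ▸ hβ)
        (b := ⟨v, hpv⟩) (by
          change (BipRel.twos (biRel G p)).card + _ = _
          omega) (by rw [← hv]; exact BipRel.deg_biRel hp ⟨v, hpv⟩)
      refine ⟨w, ⟨hw.1, (BipRel.deg_flip_biRel hp w).symm.trans hw.2⟩, fun x hx => ?_⟩
      exact congrArg Subtype.val (hwu ⟨x, (hp _ _ hx.1).1 hpv⟩
        ⟨hx.1, (BipRel.deg_flip_biRel hp _).trans hx.2⟩)
    · obtain ⟨w, hw, hwu⟩ := h.existsUnique_of_extremal hβ (b := ⟨v, hpv⟩) (by omega)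
        (by rw [← hv]; exact BipRel.deg_flip_biRel hp ⟨v, hpv⟩)
      refine ⟨w, ⟨hw.1.symm, (BipRel.deg_biRel hp w).symm.trans hw.2⟩, fun x hx => ?_⟩
      exact congrArg Subtype.val (hwu ⟨x, (hp _ _ hx.1.symm).2 hpv⟩
        ⟨hx.1.symm, (BipRel.deg_biRel hp _).trans hx.2⟩)
  refine ⟨hu, ?_⟩
  rw [BipRel.ncard_twoEdge hp hu, ← BipRel.card_twos_biRel hp]
  omega
end
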